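/- As t → ∞, θ(x,t) → A uniformly in x ∈ [0,1]. -/

import Mathlib

open MeasureTheory Real Set Filter Topology

/-- A classical solution on `[0,1] × [0,∞)` of the rescaled stress-free
one-dimensional compressible Navier–Stokes system
`u_t + u = v_x`, `v_t = ((v_x - θ)/u)_x`,
`θ_t = -θ v_x/u + v_x²/u + (θ^β θ_x/u)_x` (β > 0),
with stress-free, thermally insulated boundary conditions and positive data. -/
structure NSSol where
  β : ℝ
  hβ : 0 < β
  u : ℝ → ℝ → ℝ
  v : ℝ → ℝ → ℝ
  θ : ℝ → ℝ → ℝ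
  ux : ℝ → ℝ → ℝ
  ut : ℝ → ℝ → ℝ
  vx : ℝ → ℝ → ℝ
  vt : ℝ → ℝ → ℝ
  vxx : ℝ → ℝ → ℝ
  θx : ℝ → ℝ → ℝ
  θt : ℝ → ℝ → ℝ
  θxx : ℝ → ℝ → ℝ
  hu_pos : ∀ x ∈ Icc (0:ℝ) 1, ∀ t ∈ Ici (0:ℝ), 0 < u x t
  hθ_pos : ∀ x ∈ Icc (0:ℝ) 1, ∀ t ∈ Ici (0:ℝ), 0 < θ x t
  hux : ∀ x ∈ Icc (0:ℝ) 1, ∀ t ∈ Ici (0:ℝ),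
    HasDerivWithinAt (fun y => u y t) (ux x t) (Icc 0 1) x
  hut : ∀ x ∈ Icc (0:ℝ) 1, ∀ t ∈ Ici (0:ℝ),
    HasDerivWithinAt (fun s => u x s) (ut x t) (Ici 0) t
  hvx : ∀ x ∈ Icc (0:ℝ) 1, ∀ t ∈ Ici (0:ℝ),
    HasDerivWithinAt (fun y => v y t) (vx x t) (Icc 0 1) x
  hvt : ∀ x ∈ Icc (0:ℝ) 1, ∀ t ∈ Ici (0:ℝ),
    HasDerivWithinAt (fun s => v x s) (vt x t) (Ici 0) t
  hvxx : ∀ x ∈ Icc (0:ℝ) 1, ∀ t ∈ Ici (0:ℝ),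
    HasDerivWithinAt (fun y => vx y t) (vxx x t) (Icc 0 1) x
  hθx : ∀ x ∈ Icc (0:ℝ) 1, ∀ t ∈ Ici (0:ℝ),
    HasDerivWithinAt (fun y => θ y t) (θx x t) (Icc 0 1) x
  hθt : ∀ x ∈ Icc (0:ℝ) 1, ∀ t ∈ Ici (0:ℝ),
    HasDerivWithinAt (fun s => θ x s) (θt x t) (Ici 0) t
  hθxx : ∀ x ∈ Icc (0:ℝ) 1, ∀ t ∈ Ici (0:ℝ),
    HasDerivWithinAt (fun y => θx y t) (θxx x t) (Icc 0 1) x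
  hu_cont : ContinuousOn (Function.uncurry u) (Icc 0 1 ×ˢ Ici 0)
  hv_cont : ContinuousOn (Function.uncurry v) (Icc 0 1 ×ˢ Ici 0)
  hθ_cont : ContinuousOn (Function.uncurry θ) (Icc 0 1 ×ˢ Ici 0)
  hux_cont : ContinuousOn (Function.uncurry ux) (Icc 0 1 ×ˢ Ici 0)
  hut_cont : ContinuousOn (Function.uncurry ut) (Icc 0 1 ×ˢ Ici 0)
  hvx_cont : ContinuousOn (Function.uncurry vx) (Icc 0 1 ×ˢ Ici 0)
  hvt_cont : ContinuousOn (Function.uncurry vt) (Icc 0 1 ×ˢ Ici 0)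
  hvxx_cont : ContinuousOn (Function.uncurry vxx) (Icc 0 1 ×ˢ Ici 0)
  hθx_cont : ContinuousOn (Function.uncurry θx) (Icc 0 1 ×ˢ Ici 0)
  hθt_cont : ContinuousOn (Function.uncurry θt) (Icc 0 1 ×ˢ Ici 0)
  hθxx_cont : ContinuousOn (Function.uncurry θxx) (Icc 0 1 ×ˢ Ici 0)
  mass : ∀ x ∈ Icc (0:ℝ) 1, ∀ t ∈ Ici (0:ℝ), ut x t + u x t = vx x t
  momentum : ∀ x ∈ Icc (0:ℝ) 1, ∀ t ∈ Ici (0:ℝ),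
    HasDerivWithinAt (fun y => (vx y t - θ y t) / u y t) (vt x t) (Icc 0 1) x
  energyEq : ∀ x ∈ Icc (0:ℝ) 1, ∀ t ∈ Ici (0:ℝ),
    HasDerivWithinAt (fun y => θ y t ^ β * θx y t / u y t)
      (θt x t + θ x t * vx x t / u x t - (vx x t) ^ 2 / u x t) (Icc 0 1) x
  bc0 : ∀ t ∈ Ici (0:ℝ), (vx 0 t - θ 0 t) / u 0 t = 0
  bc1 : ∀ t ∈ Ici (0:ℝ), (vx 1 t - θ 1 t) / u 1 t = 0
  bcθ0 : ∀ t ∈ Ici (0:ℝ), θx 0 t = 0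
  bcθ1 : ∀ t ∈ Ici (0:ℝ), θx 1 t = 0

namespace NSSol

/-- The initial energy `E₀ = ∫₀¹ (v₀²/2 + θ₀) dx`. -/
noncomputable def E₀ (S : NSSol) : ℝ := ∫ x in (0:ℝ)..1, ((S.v x 0) ^ 2 / 2 + S.θ x 0)

/-- The dissipation functional
`V(t) = ∫₀¹ (θ^β θ_x²/(uθ²) + (v_x − θ)²/(uθ)) dx`. -/
noncomputable def V (S : NSSol) (t : ℝ) : ℝ :=
  ∫ x in (0:ℝ)..1,
    (S.θ x t ^ S.β * (S.θx x t) ^ 2 / (S.u x t * (S.θ x t) ^ 2)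
      + (S.vx x t - S.θ x t) ^ 2 / (S.u x t * S.θ x t))

/-- The auxiliary velocity
`w(x,t) = v(x,t) − ∫₀¹ v₀ dξ − ∫₀ˣ u(ξ,t) dξ + ∫₀¹∫₀^ξ u(η,t) dη dξ`,
which satisfies `w_x = v_x − u` and `∫₀¹ w dx = 0`. -/
noncomputable def w (S : NSSol) (x t : ℝ) : ℝ :=
  S.v x t - (∫ ξ in (0:ℝ)..1, S.v ξ 0) - (∫ ξ in (0:ℝ)..x, S.u ξ t)
    + ∫ ξ in (0:ℝ)..1, ∫ η in (0:ℝ)..ξ, S.u η t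

/-- The asymptotic state `A = 2√(36 + 3(2E₀ − (∫₀¹ v₀ dx)²)) − 12`. -/
noncomputable def A (S : NSSol) : ℝ :=
  2 * Real.sqrt (36 + 3 * (2 * S.E₀ - (∫ x in (0:ℝ)..1, S.v x 0) ^ 2)) - 12

end NSSol

/-- Fundamental theorem of calculus with a globally continuous derivative. -/
theorem integral_eq_sub_of_continuous {F F' : ℝ → ℝ} {a b : ℝ} (hab : a ≤ b)
    (hF : ContinuousOn F (Icc a b)) (hF' : Continuous F')
    (hd : ∀ x ∈ Ioo a b, HasDerivAt F (F' x) x) :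
    ∫ x in a..b, F' x = F b - F a :=
  intervalIntegral.integral_eq_sub_of_hasDerivAt_of_le hab hF hd (hF'.intervalIntegrable _ _)

/-- A function whose derivative is nonpositive decreases. -/
theorem le_of_hasDerivAt_nonpos {F F' : ℝ → ℝ} {a b : ℝ} (hab : a ≤ b)
    (hF : ContinuousOn F (Icc a b)) (hd : ∀ x ∈ Ioo a b, HasDerivAt F (F' x) x)
    (hn : ∀ x ∈ Ioo a b, F' x ≤ 0) : F b ≤ F a := by
  refine antitoneOn_of_deriv_nonpos (convex_Icc a b) hF ?_ ?_ (left_mem_Icc.2 hab)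
    (right_mem_Icc.2 hab) hab
  · intro x hx
    rw [interior_Icc] at hx
    exact (hd x hx).differentiableAt.differentiableWithinAt
  · intro x hx
    rw [interior_Icc] at hx
    rw [(hd x hx).deriv]
    exact hn x hx

/-- Differentiation under the integral sign, for positive times. -/
theorem hasDerivAt_integral_param {f ft : ℝ → ℝ → ℝ} (hf : Continuous (Function.uncurry f))
    (hft : Continuous (Function.uncurry ft)) (a b : ℝ)
    (hd : ∀ x, ∀ t > (0 : ℝ), HasDerivAt (fun s => f x s) (ft x t) t) {t : ℝ} (ht : 0 < t) :
    HasDerivAt (fun s => ∫ x in a..b, f x s) (∫ x in a..b, ft x t) t := by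
  obtain ⟨C, hC⟩ := ((isCompact_uIcc (a := a) (b := b)).prod
    (isCompact_Icc (a := 0) (b := t + 1))).exists_bound_of_continuousOn hft.continuousOn
  refine (intervalIntegral.hasDerivAt_integral_of_dominated_loc_of_deriv_le
    (F := fun s x => f x s) (F' := fun s x => ft x s) (bound := fun _ => C)
    (Ioo_mem_nhds ht (lt_add_one t)) ?_ ?_ ?_ ?_ ?_ ?_).2
  · exact Eventually.of_forall fun s =>
      (show Continuous fun x => f x s by fun_prop).aestronglyMeasurable
  · exact (show Continuous fun x => f x t by fun_prop).intervalIntegrable _ _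
  · exact (show Continuous fun x => ft x t by fun_prop).aestronglyMeasurable
  · exact Eventually.of_forall fun x hx s hs =>
      hC (x, s) ⟨uIoc_subset_uIcc hx, hs.1.le, hs.2.le⟩
  · exact _root_.intervalIntegrable_const
  · exact Eventually.of_forall fun x _ s hs => hd x s hs.1

theorem continuous_integral_param {f : ℝ → ℝ → ℝ} (hf : Continuous (Function.uncurry f))
    (a b : ℝ) : Continuous fun t => ∫ x in a..b, f x t :=
  intervalIntegral.continuous_parametric_intervalIntegral_of_continuous'
    (f := fun t x => f x t) (by fun_prop) a b

/-- Weighted Cauchy–Schwarz estimate for an increment on the unit interval. -/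
theorem sq_sub_le_of_sq_deriv_le {F F' D W : ℝ → ℝ} (hF : Continuous F) (hF' : Continuous F')
    (hD : Continuous D) (hW : Continuous W)
    (hd : ∀ x ∈ Ioo (0 : ℝ) 1, HasDerivAt F (F' x) x)
    (hD0 : ∀ x ∈ Icc (0 : ℝ) 1, 0 ≤ D x) (hW0 : ∀ x ∈ Icc (0 : ℝ) 1, 0 ≤ W x)
    (h : ∀ x ∈ Icc (0 : ℝ) 1, F' x ^ 2 ≤ D x * W x)
    {x y : ℝ} (hx : x ∈ Icc (0 : ℝ) 1) (hy : y ∈ Icc (0 : ℝ) 1) :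
    (F x - F y) ^ 2 ≤ (∫ ξ in (0 : ℝ)..1, D ξ) * ∫ ξ in (0 : ℝ)..1, W ξ := by
  wlog hxy : y ≤ x generalizing x y
  · rw [← neg_sub, neg_sq]
    exact this hy hx (le_of_not_ge hxy)
  have hi : ∫ ξ in y..x, F' ξ = F x - F y :=
    integral_eq_sub_of_continuous hxy hF.continuousOn hF' fun ξ hξ =>
      hd ξ ⟨hy.1.trans_lt hξ.1, hξ.2.trans_le hx.2⟩
  have mono : ∀ G : ℝ → ℝ, Continuous G → (∀ ξ ∈ Icc (0 : ℝ) 1, 0 ≤ G ξ) →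
      ∫ ξ in y..x, G ξ ≤ ∫ ξ in (0 : ℝ)..1, G ξ := by
    intro G hG hG0
    refine intervalIntegral.integral_mono_interval hy.1 hxy hx.2 ?_ (hG.intervalIntegrable _ _)
    exact (ae_restrict_mem measurableSet_Ioc).mono fun ξ hξ => hG0 ξ ⟨hξ.1.le, hξ.2⟩
  have nonneg : ∀ G : ℝ → ℝ, (∀ ξ ∈ Icc (0 : ℝ) 1, 0 ≤ G ξ) → 0 ≤ ∫ ξ in y..x, G ξ := by
    intro G hG0
    exact intervalIntegral.integral_nonneg hxy fun ξ hξ => hG0 ξ ⟨hy.1.trans hξ.1, hξ.2.trans hx.2⟩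
  have quad : ∀ l : ℝ, 0 ≤ (∫ ξ in y..x, D ξ) * (l * l) + (-2 * (F x - F y)) * l
      + ∫ ξ in y..x, W ξ := by
    intro l
    have : 0 ≤ ∫ ξ in y..x, (D ξ * (l * l) + (-2 * F' ξ) * l + W ξ) := by
      refine intervalIntegral.integral_nonneg hxy fun ξ hξ => ?_
      have hξ' : ξ ∈ Icc (0 : ℝ) 1 := ⟨hy.1.trans hξ.1, hξ.2.trans hx.2⟩
      have h1 := h ξ hξ'
      have h2 : (2 * F' ξ * l) ^ 2 ≤ (D ξ * (l * l) + W ξ) ^ 2 := by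
        nlinarith [sq_nonneg (D ξ * (l * l) - W ξ), mul_le_mul_of_nonneg_left h1 (sq_nonneg l)]
      have h3 := abs_le_of_sq_le_sq' h2 (by
        have := mul_nonneg (hD0 ξ hξ') (mul_self_nonneg l); linarith [hW0 ξ hξ'])
      linarith [h3.2]
    rw [intervalIntegral.integral_add, intervalIntegral.integral_add,
      intervalIntegral.integral_mul_const, intervalIntegral.integral_mul_const,
      intervalIntegral.integral_const_mul, hi] at this
    · exact this
    all_goals exact Continuous.intervalIntegrable (by fun_prop) _ _
  have hdisc := discrim_le_zero quad
  rw [discrim] at hdisc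
  calc (F x - F y) ^ 2 ≤ (∫ ξ in y..x, D ξ) * ∫ ξ in y..x, W ξ := by linarith
    _ ≤ _ := mul_le_mul (mono D hD hD0) (mono W hW hW0) (nonneg W hW0)
      ((nonneg D hD0).trans (mono D hD hD0))

/-- At a spatial maximum under no-flux boundary conditions the divergence of the flux is
nonpositive. -/
theorem flux_deriv_nonpos_of_isMax {g gx a qx : ℝ → ℝ} (hg : Continuous g) (hgx : Continuous gx)
    (ha : Continuous a) (hqx : Continuous qx) (ha0 : ∀ x, 0 < a x)
    (hdg : ∀ x ∈ Ioo (0 : ℝ) 1, HasDerivAt g (gx x) x)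
    (hdq : ∀ x ∈ Ioo (0 : ℝ) 1, HasDerivAt (fun y => a y * gx y) (qx x) x)
    (h0 : gx 0 = 0) (h1 : gx 1 = 0) {x₁ : ℝ} (hx₁ : x₁ ∈ Icc (0 : ℝ) 1)
    (hmax : ∀ y ∈ Icc (0 : ℝ) 1, g y ≤ g x₁) : qx x₁ ≤ 0 := by
  by_contra! hpos
  have hzero : gx x₁ = 0 := by
    rcases hx₁.1.eq_or_lt with h | hl
    · rwa [← h]
    rcases hx₁.2.eq_or_lt with h | hr
    · rwa [h]
    refine IsLocalMax.hasDerivAt_eq_zero ?_ (hdg x₁ ⟨hl, hr⟩)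
    filter_upwards [Icc_mem_nhds hl hr] with y hy using hmax y hy
  obtain ⟨δ, hδ, hball⟩ := Metric.eventually_nhds_iff.1 (hqx.continuousAt.eventually_const_lt hpos)
  have hmono : ∀ c d, 0 ≤ c → d ≤ 1 → x₁ - δ < c → d < x₁ + δ →
      StrictMonoOn (fun y => a y * gx y) (Icc c d) := by
    intro c d hc hd hcδ hdδ
    refine strictMonoOn_of_deriv_pos (convex_Icc c d) (by fun_prop) fun y hy => ?_
    rw [interior_Icc] at hy
    rw [(hdq y ⟨hc.trans_lt hy.1, hy.2.trans_le hd⟩).deriv]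
    refine hball ?_
    rw [Real.dist_eq, abs_lt]
    constructor <;> linarith [hy.1, hy.2]
  rcases hx₁.2.eq_or_lt with h | hr
  · subst h
    set y := max 0 (1 - δ / 2) with hy
    have hy0 : 0 ≤ y := le_max_left _ _
    have hyδ : 1 - δ / 2 ≤ y := le_max_right _ _
    have hy1 : y < 1 := max_lt one_pos (by linarith)
    have hq := hmono y 1 hy0 le_rfl (by linarith) (by linarith)
    have hanti : StrictAntiOn g (Icc y 1) := by
      refine strictAntiOn_of_deriv_neg (convex_Icc y 1) hg.continuousOn fun ξ hξ => ?_
      rw [interior_Icc] at hξ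
      rw [(hdg ξ ⟨hy0.trans_lt hξ.1, hξ.2⟩).deriv]
      have := hq ⟨hξ.1.le, hξ.2.le⟩ (right_mem_Icc.2 hy1.le) hξ.2
      simp only [hzero, mul_zero] at this
      exact (mul_neg_iff.1 this).elim (fun h => h.2) fun h => absurd h.1 (ha0 ξ).not_gt
    exact (hmax y ⟨hy0, hy1.le⟩).not_gt
      (hanti (left_mem_Icc.2 hy1.le) (right_mem_Icc.2 hy1.le) hy1)
  · set y := min 1 (x₁ + δ / 2) with hy
    have hy0 : y ≤ 1 := min_le_left _ _
    have hyδ : y ≤ x₁ + δ / 2 := min_le_right _ _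
    have hy1 : x₁ < y := lt_min hr (by linarith)
    have hq := hmono x₁ y hx₁.1 hy0 (by linarith) (by linarith)
    have hm : StrictMonoOn g (Icc x₁ y) := by
      refine strictMonoOn_of_deriv_pos (convex_Icc x₁ y) hg.continuousOn fun ξ hξ => ?_
      rw [interior_Icc] at hξ
      rw [(hdg ξ ⟨hx₁.1.trans_lt hξ.1, hξ.2.trans_le hy0⟩).deriv]
      have := hq (left_mem_Icc.2 hy1.le) ⟨hξ.1.le, hξ.2.le⟩ hξ.1
      simp only [hzero, mul_zero] at this
      exact (pos_iff_pos_of_mul_pos this).1 (ha0 ξ)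
    exact (hmax y ⟨hx₁.1.trans hy1.le, hy0⟩).not_gt
      (hm (left_mem_Icc.2 hy1.le) (right_mem_Icc.2 hy1.le) hy1)

/-- If `f < z` on `[0,1]` at time `s` but not up to time `τ`, there is a first time of contact. -/
theorem exists_first_contact {f : ℝ → ℝ → ℝ} {z : ℝ → ℝ} (hf : Continuous (Function.uncurry f))
    (hz : Continuous z) {s τ : ℝ} (hinit : ∀ x ∈ Icc (0 : ℝ) 1, f x s < z s)
    (hcontact : ∃ x ∈ Icc (0 : ℝ) 1, ∃ t ∈ Icc s τ, z t ≤ f x t) :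
    ∃ x₁ ∈ Icc (0 : ℝ) 1, ∃ t₁ ∈ Ioc s τ, f x₁ t₁ = z t₁ ∧
      (∀ x ∈ Icc (0 : ℝ) 1, ∀ t ∈ Ico s t₁, f x t < z t) ∧
      ∀ x ∈ Icc (0 : ℝ) 1, f x t₁ ≤ z t₁ := by
  set K : Set (ℝ × ℝ) := (Icc 0 1 ×ˢ Icc s τ) ∩ {p | z p.2 ≤ f p.1 p.2} with hK
  have hKc : IsCompact K := (isCompact_Icc.prod isCompact_Icc).inter_right
    (isClosed_le (by fun_prop) (by fun_prop))
  obtain ⟨x, hx, t, ht, hzf⟩ := hcontact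
  obtain ⟨⟨x₁, t₁⟩, ⟨⟨hx₁, ht₁⟩, hle⟩, hmin⟩ :=
    hKc.exists_isMinOn ⟨(x, t), ⟨hx, ht⟩, hzf⟩ continuous_snd.continuousOn
  simp only [mem_ofPred_eq] at hx₁ ht₁ hle
  have hst : s < t₁ := by
    rcases ht₁.1.eq_or_lt with h | h
    · subst h
      exact absurd (hinit x₁ hx₁) hle.not_gt
    · exact h
  have hbefore : ∀ x ∈ Icc (0 : ℝ) 1, ∀ t ∈ Ico s t₁, f x t < z t := by
    intro x hx t ht
    by_contra! hcon
    have := isMinOn_iff.1 hmin (x, t) ⟨⟨hx, ht.1, ht.2.le.trans ht₁.2⟩, hcon⟩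
    exact ht.2.not_ge this
  have hat : ∀ x ∈ Icc (0 : ℝ) 1, f x t₁ ≤ z t₁ := by
    intro x hx
    have hmem : t₁ ∈ closure (Ico s t₁) := by
      rw [closure_Ico hst.ne]
      exact right_mem_Icc.2 hst.le
    exact closure_minimal (s := Ico s t₁) (t := {t | f x t ≤ z t})
      (fun t ht => (hbefore x hx t ht).le) (isClosed_le (by fun_prop) hz) hmem
  exact ⟨x₁, hx₁, t₁, ⟨hst, ht₁.2⟩, (hat x₁ hx₁).antisymm hle, hbefore, hat⟩

/-- Comparison principle for a no-flux parabolic inequality on `[0,1]`. -/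
theorem lt_of_parabolic {f ft fx a qx : ℝ → ℝ → ℝ} {z z' : ℝ → ℝ}
    (hf : Continuous (Function.uncurry f)) (hfx : Continuous (Function.uncurry fx))
    (ha : Continuous (Function.uncurry a)) (hqx : Continuous (Function.uncurry qx))
    (ha0 : ∀ x t, 0 < a x t)
    (hdf : ∀ x ∈ Ioo (0 : ℝ) 1, ∀ t, HasDerivAt (fun y => f y t) (fx x t) x)
    (hdq : ∀ x ∈ Ioo (0 : ℝ) 1, ∀ t, HasDerivAt (fun y => a y t * fx y t) (qx x t) x)
    (h0 : ∀ t, fx 0 t = 0) (h1 : ∀ t, fx 1 t = 0) {s τ : ℝ}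
    (hdt : ∀ x, ∀ t > s, HasDerivAt (fun r => f x r) (ft x t) t)
    (hz : ∀ t, HasDerivAt z (z' t) t)
    (hsrc : ∀ t ∈ Ioc s τ, ∀ x ∈ Icc (0 : ℝ) 1, ft x t < z' t + qx x t)
    (hinit : ∀ x ∈ Icc (0 : ℝ) 1, f x s < z s) {x t : ℝ} (hx : x ∈ Icc (0 : ℝ) 1)
    (ht : t ∈ Icc s τ) : f x t < z t := by
  have hzc : Continuous z := continuous_iff_continuousAt.2 fun t => (hz t).continuousAt
  by_contra! hcon
  obtain ⟨x₁, hx₁, t₁, ht₁, heq, hbefore, hat⟩ :=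
    exists_first_contact hf hzc hinit ⟨x, hx, t, ht, hcon⟩
  have hflux : qx x₁ t₁ ≤ 0 :=
    flux_deriv_nonpos_of_isMax (g := fun y => f y t₁) (gx := fun y => fx y t₁)
      (a := fun y => a y t₁) (qx := fun y => qx y t₁) (by fun_prop) (by fun_prop) (by fun_prop)
      (by fun_prop) (fun y => ha0 y t₁) (fun y hy => hdf y hy t₁) (fun y hy => hdq y hy t₁)
      (h0 t₁) (h1 t₁) hx₁ fun y hy => heq ▸ hat y hy
  have hslope : z' t₁ ≤ ft x₁ t₁ := by
    have hder : HasDerivAt (fun r => f x₁ r - z r) (ft x₁ t₁ - z' t₁) t₁ :=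
      (hdt x₁ t₁ ht₁.1).sub (hz t₁)
    have hlim := hder.tendsto_slope.mono_left
      (nhdsWithin_mono t₁ (show Iio t₁ ⊆ {t₁}ᶜ from fun r hr => ne_of_lt hr))
    have : 0 ≤ ft x₁ t₁ - z' t₁ := by
      refine ge_of_tendsto hlim ?_
      filter_upwards [Ico_mem_nhdsLT ht₁.1] with r hr
      rw [slope_def_field, heq, sub_self, sub_zero]
      exact div_nonneg_of_nonpos (sub_nonpos.2 (hbefore x₁ hx₁ r hr).le) (sub_nonpos.2 hr.2.le)
    linarith
  linarith [hsrc t₁ ht₁ x₁ hx₁]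

/-- A solution of the rescaled system whose component functions are extended continuously to the
whole plane. -/
structure GlobalSol where
  β : ℝ
  hβ : 0 < β
  u : ℝ → ℝ → ℝ
  v : ℝ → ℝ → ℝ
  θ : ℝ → ℝ → ℝ
  vx : ℝ → ℝ → ℝ
  vt : ℝ → ℝ → ℝ
  θx : ℝ → ℝ → ℝ
  θt : ℝ → ℝ → ℝ
  u_pos : ∀ x t, 0 < u x t
  θ_pos : ∀ x t, 0 < θ x t
  cu : Continuous (Function.uncurry u)
  cv : Continuous (Function.uncurry v)
  cθ : Continuous (Function.uncurry θ)
  cvx : Continuous (Function.uncurry vx)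
  cvt : Continuous (Function.uncurry vt)
  cθx : Continuous (Function.uncurry θx)
  cθt : Continuous (Function.uncurry θt)
  dv_x : ∀ x ∈ Ioo (0 : ℝ) 1, ∀ t, HasDerivAt (fun y => v y t) (vx x t) x
  dθ_x : ∀ x ∈ Ioo (0 : ℝ) 1, ∀ t, HasDerivAt (fun y => θ y t) (θx x t) x
  du_t : ∀ x, ∀ t > (0 : ℝ), HasDerivAt (fun s => u x s) (vx x t - u x t) t
  dv_t : ∀ x, ∀ t > (0 : ℝ), HasDerivAt (fun s => v x s) (vt x t) t
  dθ_t : ∀ x, ∀ t > (0 : ℝ), HasDerivAt (fun s => θ x s) (θt x t) t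
  momentum : ∀ x ∈ Ioo (0 : ℝ) 1, ∀ t,
    HasDerivAt (fun y => (vx y t - θ y t) / u y t) (vt x t) x
  energy : ∀ x ∈ Ioo (0 : ℝ) 1, ∀ t,
    HasDerivAt (fun y => θ y t ^ β / u y t * θx y t)
      (θt x t - vx x t * ((vx x t - θ x t) / u x t)) x
  stress_zero : ∀ t, (vx 0 t - θ 0 t) / u 0 t = 0
  stress_one : ∀ t, (vx 1 t - θ 1 t) / u 1 t = 0
  θx_zero : ∀ t, θx 0 t = 0
  θx_one : ∀ t, θx 1 t = 0

/-- Extension of a function on `[0,1] × [0,∞)` to the plane, constant outside. -/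
noncomputable def clampExtend (f : ℝ → ℝ → ℝ) (x t : ℝ) : ℝ := f (max 0 (min x 1)) (max 0 t)

theorem clamp_mem (x : ℝ) : max 0 (min x 1) ∈ Icc (0 : ℝ) 1 :=
  ⟨le_max_left _ _, max_le zero_le_one (min_le_right _ _)⟩

theorem clamp_time_mem (t : ℝ) : max 0 t ∈ Ici (0 : ℝ) := mem_Ici.2 (le_max_left _ _)

theorem clamp_eq {x : ℝ} (hx : x ∈ Icc (0 : ℝ) 1) : max 0 (min x 1) = x := by
  rw [min_eq_left hx.2, max_eq_right hx.1]

theorem clampExtend_eq (f : ℝ → ℝ → ℝ) {x t : ℝ} (hx : x ∈ Icc (0 : ℝ) 1) (ht : 0 ≤ t) :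
    clampExtend f x t = f x t := by
  rw [clampExtend, clamp_eq hx, max_eq_right ht]

theorem continuous_clampExtend {f : ℝ → ℝ → ℝ}
    (hf : ContinuousOn (Function.uncurry f) (Icc 0 1 ×ˢ Ici 0)) :
    Continuous (Function.uncurry (clampExtend f)) :=
  hf.comp_continuous (f := fun p : ℝ × ℝ => (max 0 (min p.1 1), max 0 p.2)) (by fun_prop)
    fun p => ⟨clamp_mem p.1, clamp_time_mem p.2⟩

theorem hasDerivAt_clamp_space {g : ℝ → ℝ → ℝ} {d : ℝ → ℝ → ℝ}
    (h : ∀ x ∈ Icc (0 : ℝ) 1, ∀ t ∈ Ici (0 : ℝ),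
      HasDerivWithinAt (fun y => g y t) (d x t) (Icc 0 1) x) :
    ∀ x ∈ Ioo (0 : ℝ) 1, ∀ t, HasDerivAt (fun y => clampExtend g y t) (clampExtend d x t) x := by
  intro x hx t
  have h1 := (h x (Ioo_subset_Icc_self hx) (max 0 t) (clamp_time_mem t)).hasDerivAt
    (Icc_mem_nhds hx.1 hx.2)
  rw [clampExtend, clamp_eq (Ioo_subset_Icc_self hx)]
  refine h1.congr_of_eventuallyEq ?_
  filter_upwards [Icc_mem_nhds hx.1 hx.2] with y hy
  rw [clampExtend, clamp_eq hy]

theorem hasDerivAt_clamp_time {g : ℝ → ℝ → ℝ} {d : ℝ → ℝ → ℝ}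
    (h : ∀ x ∈ Icc (0 : ℝ) 1, ∀ t ∈ Ici (0 : ℝ),
      HasDerivWithinAt (fun s => g x s) (d x t) (Ici 0) t) :
    ∀ x, ∀ t > (0 : ℝ), HasDerivAt (fun s => clampExtend g x s) (clampExtend d x t) t := by
  intro x t ht
  have h1 := (h _ (clamp_mem x) t ht.le).hasDerivAt (Ici_mem_nhds ht)
  rw [clampExtend, max_eq_right ht.le]
  refine h1.congr_of_eventuallyEq ?_
  filter_upwards [Ici_mem_nhds ht] with s hs
  simp only [clampExtend, max_eq_right (mem_Ici.1 hs)]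

/-- The extension of a classical solution to the plane. -/
noncomputable def NSSol.toGlobalSol (S : NSSol) : GlobalSol where
  β := S.β
  hβ := S.hβ
  u := clampExtend S.u
  v := clampExtend S.v
  θ := clampExtend S.θ
  vx := clampExtend S.vx
  vt := clampExtend S.vt
  θx := clampExtend S.θx
  θt := clampExtend S.θt
  u_pos x t := S.hu_pos _ (clamp_mem x) _ (clamp_time_mem t)
  θ_pos x t := S.hθ_pos _ (clamp_mem x) _ (clamp_time_mem t)
  cu := continuous_clampExtend S.hu_cont
  cv := continuous_clampExtend S.hv_cont
  cθ := continuous_clampExtend S.hθ_cont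
  cvx := continuous_clampExtend S.hvx_cont
  cvt := continuous_clampExtend S.hvt_cont
  cθx := continuous_clampExtend S.hθx_cont
  cθt := continuous_clampExtend S.hθt_cont
  dv_x := hasDerivAt_clamp_space S.hvx
  dθ_x := hasDerivAt_clamp_space S.hθx
  du_t x t ht := by
    have h := hasDerivAt_clamp_time S.hut x t ht
    have := S.mass _ (clamp_mem x) _ (clamp_time_mem t)
    rw [← eq_sub_iff_add_eq] at this
    rwa [clampExtend, this] at h
  dv_t := hasDerivAt_clamp_time S.hvt
  dθ_t := hasDerivAt_clamp_time S.hθt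
  momentum := hasDerivAt_clamp_space S.momentum
  energy x hx t := by
    have h := hasDerivAt_clamp_space S.energyEq x hx t
    convert h using 1
    · ext y
      simp only [clampExtend]
      ring
    · simp only [clampExtend]
      ring
  stress_zero t := by
    simpa [clampExtend] using S.bc0 (max 0 t) (clamp_time_mem t)
  stress_one t := by
    simpa [clampExtend] using S.bc1 (max 0 t) (clamp_time_mem t)
  θx_zero t := by
    simpa [clampExtend] using S.bcθ0 (max 0 t) (clamp_time_mem t)
  θx_one t := by
    simpa [clampExtend] using S.bcθ1 (max 0 t) (clamp_time_mem t)

/-- Time increment of a parametric integral. -/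
theorem integral_param_sub {f ft : ℝ → ℝ → ℝ} (hf : Continuous (Function.uncurry f))
    (hft : Continuous (Function.uncurry ft))
    (hd : ∀ x, ∀ t > (0 : ℝ), HasDerivAt (fun s => f x s) (ft x t) t) (c d : ℝ) {a b : ℝ}
    (ha : 0 ≤ a) (hab : a ≤ b) :
    (∫ x in c..d, f x b) - ∫ x in c..d, f x a = ∫ t in a..b, ∫ x in c..d, ft x t :=
  (integral_eq_sub_of_continuous (F := fun t => ∫ x in c..d, f x t) hab
    (continuous_integral_param hf c d).continuousOn (continuous_integral_param hft c d)
    fun _ ht => hasDerivAt_integral_param hf hft c d hd (ha.trans_lt ht.1)).symm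

namespace GlobalSol

variable (S : GlobalSol)

/-- The stress `σ = (v_x - θ) / u`. -/
noncomputable def σ (x t : ℝ) : ℝ := (S.vx x t - S.θ x t) / S.u x t

/-- The heat flux `q = θ^β θ_x / u`. -/
noncomputable def q (x t : ℝ) : ℝ := S.θ x t ^ S.β / S.u x t * S.θx x t

/-- The spatial derivative of the heat flux. -/
noncomputable def qx (x t : ℝ) : ℝ := S.θt x t - S.vx x t * S.σ x t

/-- The density of the dissipation functional. -/
noncomputable def D (x t : ℝ) : ℝ :=
  S.θ x t ^ S.β / S.u x t * S.θx x t ^ 2 / S.θ x t ^ 2 + S.u x t * S.σ x t ^ 2 / S.θ x t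

/-- The dissipation functional. -/
noncomputable def V (t : ℝ) : ℝ := ∫ x in (0 : ℝ)..1, S.D x t

/-- The initial energy. -/
noncomputable def E : ℝ := ∫ x in (0 : ℝ)..1, (S.v x 0 ^ 2 / 2 + S.θ x 0)

/-- The total momentum. -/
noncomputable def m : ℝ := ∫ x in (0 : ℝ)..1, S.v x 0

theorem vx_eq (x t : ℝ) : S.vx x t = S.u x t * S.σ x t + S.θ x t := by
  have := (S.u_pos x t).ne'
  rw [σ]
  field_simp
  ring

theorem cσ : Continuous (Function.uncurry S.σ) :=
  (S.cvx.sub S.cθ).div S.cu fun p => (S.u_pos p.1 p.2).ne'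

theorem continuous_θ_rpow (r : ℝ) : Continuous (Function.uncurry fun x t => S.θ x t ^ r) :=
  S.cθ.rpow_const fun p => Or.inl (S.θ_pos p.1 p.2).ne'

theorem continuous_conductivity :
    Continuous (Function.uncurry fun x t => S.θ x t ^ S.β / S.u x t) :=
  (S.continuous_θ_rpow S.β).div S.cu fun p => (S.u_pos p.1 p.2).ne'

theorem cq : Continuous (Function.uncurry S.q) := S.continuous_conductivity.mul S.cθx

theorem cqx : Continuous (Function.uncurry S.qx) := S.cθt.sub (S.cvx.mul S.cσ)

theorem cD : Continuous (Function.uncurry S.D) :=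
  ((S.continuous_conductivity.mul (S.cθx.pow 2)).div (S.cθ.pow 2)
    fun p => pow_ne_zero 2 (S.θ_pos p.1 p.2).ne').add
    ((S.cu.mul (S.cσ.pow 2)).div S.cθ fun p => (S.θ_pos p.1 p.2).ne')

theorem cV : Continuous S.V := continuous_integral_param S.cD 0 1

theorem thermal_part_nonneg (x t : ℝ) :
    0 ≤ S.θ x t ^ S.β / S.u x t * S.θx x t ^ 2 / S.θ x t ^ 2 := by
  have := S.u_pos x t
  have := S.θ_pos x t
  positivity

theorem viscous_part_nonneg (x t : ℝ) : 0 ≤ S.u x t * S.σ x t ^ 2 / S.θ x t := by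
  have := S.u_pos x t
  have := S.θ_pos x t
  positivity

theorem D_nonneg (x t : ℝ) : 0 ≤ S.D x t :=
  add_nonneg (S.thermal_part_nonneg x t) (S.viscous_part_nonneg x t)

theorem V_nonneg (t : ℝ) : 0 ≤ S.V t :=
  intervalIntegral.integral_nonneg zero_le_one fun x _ => S.D_nonneg x t

theorem σ_zero (t : ℝ) : S.σ 0 t = 0 := S.stress_zero t

theorem σ_one (t : ℝ) : S.σ 1 t = 0 := S.stress_one t

theorem q_zero (t : ℝ) : S.q 0 t = 0 := by rw [q, S.θx_zero, mul_zero]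

theorem q_one (t : ℝ) : S.q 1 t = 0 := by rw [q, S.θx_one, mul_zero]

theorem dσ_x {x : ℝ} (hx : x ∈ Ioo (0 : ℝ) 1) (t : ℝ) :
    HasDerivAt (fun y => S.σ y t) (S.vt x t) x := S.momentum x hx t

theorem dq_x {x : ℝ} (hx : x ∈ Ioo (0 : ℝ) 1) (t : ℝ) :
    HasDerivAt (fun y => S.q y t) (S.qx x t) x := S.energy x hx t

/-- Conservation of momentum. -/
theorem integral_v {t : ℝ} (ht : 0 ≤ t) : ∫ x in (0 : ℝ)..1, S.v x t = S.m := by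
  have h := integral_param_sub S.cv S.cvt S.dv_t 0 1 le_rfl ht
  have h0 : ∀ s, ∫ x in (0 : ℝ)..1, S.vt x s = 0 := by
    intro s
    have cσ := S.cσ
    have cvt := S.cvt
    rw [integral_eq_sub_of_continuous (F := fun x => S.σ x s) zero_le_one (by fun_prop)
      (by fun_prop) fun x hx => S.dσ_x hx s]
    simp [S.σ_zero, S.σ_one]
  simp only [h0, intervalIntegral.integral_zero] at h
  exact sub_eq_zero.1 h

/-- Conservation of energy. -/
theorem integral_energy {t : ℝ} (ht : 0 ≤ t) :
    ∫ x in (0 : ℝ)..1, (S.v x t ^ 2 / 2 + S.θ x t) = S.E := by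
  have cσ := S.cσ
  have cvt := S.cvt
  have cv := S.cv
  have cq := S.cq
  have cθt := S.cθt
  have h := integral_param_sub (f := fun x t => S.v x t ^ 2 / 2 + S.θ x t)
    (ft := fun x t => S.v x t * S.vt x t + S.θt x t)
    (((S.cv.fun_pow 2).div_const 2).fun_add S.cθ) ((S.cv.mul S.cvt).add S.cθt)
    (fun x t ht => ((((S.dv_t x t ht).fun_pow 2).div_const 2).fun_add (S.dθ_t x t ht)).congr_deriv
      (by simp; ring)) 0 1 le_rfl ht
  have h0 : ∀ s, ∫ x in (0 : ℝ)..1, (S.v x s * S.vt x s + S.θt x s) = 0 := by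
    intro s
    rw [integral_eq_sub_of_continuous (F := fun x => S.v x s * S.σ x s + S.q x s) zero_le_one
      (by fun_prop) (by fun_prop) fun x hx =>
        (((S.dv_x x hx s).fun_mul (S.dσ_x hx s)).fun_add (S.dq_x hx s)).congr_deriv
          (by rw [qx]; ring)]
    simp [S.σ_zero, S.σ_one, S.q_zero, S.q_one]
  simp only [h0, intervalIntegral.integral_zero] at h
  exact sub_eq_zero.1 h

/-- The entropy identity. -/
theorem integral_V {a b : ℝ} (ha : 0 ≤ a) (hab : a ≤ b) :
    ∫ t in a..b, S.V t = (∫ x in (0 : ℝ)..1, (log (S.θ x b) - (1 - x) * S.v x b))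
      - ∫ x in (0 : ℝ)..1, (log (S.θ x a) - (1 - x) * S.v x a) := by
  have cσ := S.cσ
  have cvt := S.cvt
  have cv := S.cv
  have cq := S.cq
  have cθt := S.cθt
  have cθ := S.cθ
  have cD := S.cD
  have hft : Continuous (Function.uncurry fun x t => S.θt x t / S.θ x t - (1 - x) * S.vt x t) :=
    (S.cθt.div S.cθ fun p => (S.θ_pos p.1 p.2).ne').sub
      ((continuous_const.sub continuous_fst).mul S.cvt)
  rw [integral_param_sub (f := fun x t => log (S.θ x t) - (1 - x) * S.v x t)
    (ft := fun x t => S.θt x t / S.θ x t - (1 - x) * S.vt x t)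
    ((S.cθ.log fun p => (S.θ_pos p.1 p.2).ne').sub
      ((continuous_const.sub continuous_fst).mul S.cv)) hft
    (fun x t ht => ((S.dθ_t x t ht).log (S.θ_pos x t).ne').sub
      ((S.dv_t x t ht).const_mul (1 - x))) 0 1 ha hab]
  congr 1
  ext s
  have hft' : Continuous fun x => S.θt x s / S.θ x s - (1 - x) * S.vt x s :=
    hft.comp (continuous_id.prodMk continuous_const)
  rw [V, eq_comm, ← sub_eq_zero, ← intervalIntegral.integral_sub
    (Continuous.intervalIntegrable (by fun_prop) _ _)
    (Continuous.intervalIntegrable (by fun_prop) _ _)]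
  rw [integral_eq_sub_of_continuous (F := fun x => S.q x s / S.θ x s - (1 - x) * S.σ x s)
      zero_le_one ?_ (by fun_prop) fun x hx =>
        (((S.dq_x hx s).fun_div (S.dθ_x x hx s) (S.θ_pos x s).ne').fun_sub
          (((hasDerivAt_id x).const_sub 1).fun_mul (S.dσ_x hx s))).congr_deriv (by
        have h1 := (S.θ_pos x s).ne'
        have h2 := (S.u_pos x s).ne'
        simp only [qx, q, D, S.vx_eq, id]
        field_simp
        ring)]
  · simp [S.σ_zero, S.σ_one, S.q_zero, S.q_one]
  · exact (((show Continuous fun x => S.q x s by fun_prop).div (by fun_prop)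
      fun x => (S.θ_pos x s).ne').sub (by fun_prop)).continuousOn

end GlobalSol

/-- Comparison of integrals of continuous functions over the unit interval. -/
theorem integral_unit_mono {f g : ℝ → ℝ} (hf : Continuous f) (hg : Continuous g)
    (h : ∀ x ∈ Icc (0 : ℝ) 1, f x ≤ g x) :
    ∫ x in (0 : ℝ)..1, f x ≤ ∫ x in (0 : ℝ)..1, g x :=
  intervalIntegral.integral_mono_on zero_le_one (hf.intervalIntegrable _ _)
    (hg.intervalIntegrable _ _) h

namespace GlobalSol

variable (S : GlobalSol)

theorem continuous_energy_density (t : ℝ) : Continuous fun x => S.v x t ^ 2 / 2 + S.θ x t := by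
  have cv := S.cv
  have cθ := S.cθ
  fun_prop

theorem continuous_θ_rpow_slice (r t : ℝ) : Continuous fun x => S.θ x t ^ r :=
  (S.continuous_θ_rpow r).comp (continuous_id.prodMk continuous_const)

theorem continuous_log_θ (t : ℝ) : Continuous fun x => log (S.θ x t) := by
  have cθ := S.cθ
  exact (show Continuous fun x => S.θ x t by fun_prop).log fun x => (S.θ_pos x t).ne'

theorem integral_θ_le {t : ℝ} (ht : 0 ≤ t) : ∫ x in (0 : ℝ)..1, S.θ x t ≤ S.E := by
  have cθ := S.cθ
  rw [← S.integral_energy ht]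
  exact integral_unit_mono (by fun_prop) (S.continuous_energy_density t)
    fun x _ => by nlinarith [sq_nonneg (S.v x t)]

theorem E_nonneg : 0 ≤ S.E :=
  (intervalIntegral.integral_nonneg zero_le_one fun x _ => (S.θ_pos x 0).le).trans
    (S.integral_θ_le le_rfl)

theorem abs_integral_le_of_abs_le_v {g : ℝ → ℝ} {t : ℝ} (hg : Continuous g) (ht : 0 ≤ t)
    (h : ∀ x ∈ Icc (0 : ℝ) 1, |g x| ≤ |S.v x t|) {x : ℝ} (hx : x ∈ Icc (0 : ℝ) 1) :
    |∫ ξ in (0 : ℝ)..x, g ξ| ≤ S.E + 1 / 2 := by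
  have ce := S.continuous_energy_density t
  calc |∫ ξ in (0 : ℝ)..x, g ξ| ≤ ∫ ξ in (0 : ℝ)..x, |g ξ| :=
        intervalIntegral.abs_integral_le_integral_abs hx.1
    _ ≤ ∫ ξ in (0 : ℝ)..1, |g ξ| :=
        intervalIntegral.integral_mono_interval le_rfl hx.1 hx.2
          (Eventually.of_forall fun ξ => abs_nonneg _) (hg.abs.intervalIntegrable _ _)
    _ ≤ ∫ ξ in (0 : ℝ)..1, (S.v ξ t ^ 2 / 2 + S.θ ξ t + 1 / 2) := by
        refine integral_unit_mono hg.abs (by fun_prop) fun ξ hξ => ?_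
        have := sq_abs (S.v ξ t)
        nlinarith [h ξ hξ, sq_nonneg (|S.v ξ t| - 1), S.θ_pos ξ t]
    _ = S.E + 1 / 2 := by
        rw [intervalIntegral.integral_add (ce.intervalIntegrable _ _)
          (continuous_const.intervalIntegrable _ _), S.integral_energy ht]
        simp

/-- The entropy functional is bounded from above. -/
theorem entropy_le {t : ℝ} (ht : 0 ≤ t) :
    ∫ x in (0 : ℝ)..1, (log (S.θ x t) - (1 - x) * S.v x t)
      ≤ (∫ x in (0 : ℝ)..1, log (S.θ x t)) + (S.E + 1 / 2) := by
  have cv := S.cv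
  rw [intervalIntegral.integral_sub ((S.continuous_log_θ t).intervalIntegrable _ _)
    (Continuous.intervalIntegrable (by fun_prop) _ _)]
  have := S.abs_integral_le_of_abs_le_v (g := fun x => (1 - x) * S.v x t) (by fun_prop) ht
    (fun x hx => by
      rw [abs_mul]
      exact mul_le_of_le_one_left (abs_nonneg _) (abs_le.2 ⟨by linarith [hx.2], by linarith [hx.1]⟩))
    (right_mem_Icc.2 zero_le_one)
  linarith [(abs_le.1 this).1]

theorem exists_integral_V_le : ∃ C, ∀ t ≥ (0 : ℝ), ∫ s in (0 : ℝ)..t, S.V s ≤ C := by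
  refine ⟨S.E + (S.E + 1 / 2) - ∫ x in (0 : ℝ)..1, (log (S.θ x 0) - (1 - x) * S.v x 0),
    fun t ht => ?_⟩
  have cθ := S.cθ
  have h : ∫ x in (0 : ℝ)..1, log (S.θ x t) ≤ ∫ x in (0 : ℝ)..1, S.θ x t :=
    integral_unit_mono (S.continuous_log_θ t) (by fun_prop) fun x _ =>
      (log_le_sub_one_of_pos (S.θ_pos x t)).trans (by linarith)
  rw [S.integral_V le_rfl ht]
  linarith [S.entropy_le ht, S.integral_θ_le ht]

theorem integral_V_nonneg {a b : ℝ} (hab : a ≤ b) : 0 ≤ ∫ s in a..b, S.V s :=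
  intervalIntegral.integral_nonneg hab fun s _ => S.V_nonneg s

/-- The dissipation is integrable in time: its tails vanish. -/
theorem exists_tail_le {η : ℝ} (hη : 0 < η) :
    ∃ T ≥ (0 : ℝ), ∀ a ≥ T, ∀ b ≥ a, ∫ s in a..b, S.V s ≤ η := by
  obtain ⟨C, hC⟩ := S.exists_integral_V_le
  set R : Set ℝ := (fun t => ∫ s in (0 : ℝ)..t, S.V s) '' Ici 0 with hR
  have hbdd : BddAbove R := ⟨C, by rintro _ ⟨t, ht, rfl⟩; exact hC t ht⟩
  have hne : R.Nonempty := ⟨_, 0, self_mem_Ici, rfl⟩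
  obtain ⟨_, ⟨T, hT, rfl⟩, hlt⟩ := exists_lt_of_lt_csSup hne (sub_lt_self (sSup R) hη)
  refine ⟨T, hT, fun a ha b hb => ?_⟩
  have hi : ∀ c d, IntervalIntegrable S.V volume c d := fun c d => S.cV.intervalIntegrable c d
  have h1 := le_csSup hbdd ⟨b, (mem_Ici.1 hT).trans (ha.le.trans hb), rfl⟩
  have h2 := intervalIntegral.integral_add_adjacent_intervals (hi 0 T) (hi T a)
  have h3 := intervalIntegral.integral_add_adjacent_intervals (hi 0 a) (hi a b)
  have h4 := S.integral_V_nonneg ha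
  simp only at hlt h1
  linarith

theorem exists_θ_le {t : ℝ} (ht : 0 ≤ t) : ∃ y ∈ Icc (0 : ℝ) 1, S.θ y t ≤ S.E + 1 := by
  by_contra! hcon
  have cθ := S.cθ
  have := integral_unit_mono (f := fun _ => S.E + 1) continuous_const
    (show Continuous fun x => S.θ x t by fun_prop) fun x hx => (hcon x hx).le
  simp only [intervalIntegral.integral_const, sub_zero, one_smul] at this
  linarith [S.integral_θ_le ht]

/-- The maximum of the temperature is bounded away from zero uniformly in time. -/
theorem exists_le_θ : ∃ c > 0, ∀ t ≥ (0 : ℝ), ∃ y ∈ Icc (0 : ℝ) 1, c ≤ S.θ y t := by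
  set L := ∫ x in (0 : ℝ)..1, (log (S.θ x 0) - (1 - x) * S.v x 0) with hL
  refine ⟨exp (L - (S.E + 1 / 2) - 1), exp_pos _, fun t ht => ?_⟩
  by_contra! hcon
  have h1 := integral_unit_mono (S.continuous_log_θ t) (continuous_const
    (y := L - (S.E + 1 / 2) - 1)) fun x hx =>
      ((log_lt_iff_lt_exp (S.θ_pos x t)).2 (hcon x hx)).le
  simp only [intervalIntegral.integral_const, sub_zero, one_smul] at h1
  have h2 := S.integral_V le_rfl ht
  linarith [S.entropy_le ht, S.integral_V_nonneg ht]

/-- Oscillation estimate for powers of the temperature. -/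
theorem sq_sub_rpow_le (γ t : ℝ) {x y : ℝ} (hx : x ∈ Icc (0 : ℝ) 1) (hy : y ∈ Icc (0 : ℝ) 1) :
    (S.θ x t ^ (γ / 2) - S.θ y t ^ (γ / 2)) ^ 2 ≤
      S.V t * ∫ ξ in (0 : ℝ)..1, γ ^ 2 / 4 * (S.u ξ t * S.θ ξ t ^ (γ - S.β)) := by
  have cu := S.cu
  have cD := S.cD
  have cθx := S.cθx
  refine sq_sub_le_of_sq_deriv_le (F := fun x => S.θ x t ^ (γ / 2))
    (F' := fun x => S.θx x t * (γ / 2) * S.θ x t ^ (γ / 2 - 1))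
    (W := fun x => γ ^ 2 / 4 * (S.u x t * S.θ x t ^ (γ - S.β)))
    (S.continuous_θ_rpow_slice _ t)
    (Continuous.mul (by fun_prop) (S.continuous_θ_rpow_slice _ t)) (by fun_prop)
    (continuous_const.mul (Continuous.mul (by fun_prop) (S.continuous_θ_rpow_slice _ t)))
    (fun x hx => (S.dθ_x x hx t).rpow_const (Or.inl (S.θ_pos x t).ne'))
    (fun x _ => S.D_nonneg x t) (fun x _ => ?_) (fun x _ => ?_) hx hy
  · have := (S.u_pos x t).le
    have := (S.θ_pos x t).le
    positivity
  · have hu := S.u_pos x t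
    have hθ := S.θ_pos x t
    have e1 : (S.θ x t ^ (γ / 2 - 1)) ^ 2 = S.θ x t ^ S.β * S.θ x t ^ (γ - S.β) / S.θ x t ^ 2 := by
      rw [← rpow_add hθ, ← rpow_natCast (S.θ x t) 2, ← rpow_sub hθ, ← rpow_natCast, ← rpow_mul hθ.le]
      congr 1
      push_cast
      ring
    calc (S.θx x t * (γ / 2) * S.θ x t ^ (γ / 2 - 1)) ^ 2
        = (S.θ x t ^ S.β / S.u x t * S.θx x t ^ 2 / S.θ x t ^ 2)
          * (γ ^ 2 / 4 * (S.u x t * S.θ x t ^ (γ - S.β))) := by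
          rw [mul_pow, e1]
          field_simp
          ring
      _ ≤ _ := mul_le_mul_of_nonneg_right
          (le_add_of_nonneg_right (S.viscous_part_nonneg x t)) (by positivity)

/-- The temperature is controlled by the dissipation and the specific volume. -/
theorem exists_θ_le_V_mul : ∃ C > 0, ∀ t ≥ (0 : ℝ), ∀ N ≥ (0 : ℝ),
    (∀ x ∈ Icc (0 : ℝ) 1, S.u x t ≤ N) → ∀ x ∈ Icc (0 : ℝ) 1, S.θ x t ≤ C + C * (S.V t * N) := by
  set γ := max S.β 1 with hγ
  have hE := S.E_nonneg
  have hγ1 : 1 ≤ γ := le_max_right _ _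
  have hγβ : 0 ≤ γ - S.β := sub_nonneg.2 (le_max_left _ _)
  have hγβ1 : γ - S.β ≤ 1 := by
    rw [hγ, sub_le_iff_le_add]
    exact max_le (by linarith) (by linarith [S.hβ])
  set C₁ := 1 + 2 * (S.E + 1) ^ γ with hC₁
  set C₂ := γ ^ 2 / 2 * (1 + S.E) with hC₂
  have hC₁0 : 0 < C₁ := by positivity
  have hC₂0 : 0 ≤ C₂ := by positivity
  have le_one_add : ∀ s : ℝ, 0 < s → ∀ r : ℝ, 0 ≤ r → r ≤ 1 → s ^ r ≤ 1 + s := by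
    intro s hs r hr0 hr1
    rcases le_total s 1 with h | h
    · linarith [rpow_le_one hs.le h hr0]
    · have := rpow_le_rpow_of_exponent_le h hr1
      rw [rpow_one] at this
      linarith
  refine ⟨C₁ + C₂, by positivity, fun t ht N hN hu x hx => ?_⟩
  have cu := S.cu
  have cθ := S.cθ
  obtain ⟨y, hy, hyE⟩ := S.exists_θ_le ht
  have hosc := S.sq_sub_rpow_le γ t hx hy
  have hW : ∫ ξ in (0 : ℝ)..1, γ ^ 2 / 4 * (S.u ξ t * S.θ ξ t ^ (γ - S.β))
      ≤ γ ^ 2 / 4 * (N * (1 + S.E)) := by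
    calc _ ≤ ∫ ξ in (0 : ℝ)..1, γ ^ 2 / 4 * (N * (1 + S.θ ξ t)) := by
          refine integral_unit_mono (continuous_const.mul
            (Continuous.mul (by fun_prop) (S.continuous_θ_rpow_slice _ t))) (by fun_prop)
            fun ξ hξ => ?_
          have := S.θ_pos ξ t
          gcongr
          · exact hu ξ hξ
          · exact le_one_add _ (S.θ_pos ξ t) _ hγβ hγβ1
      _ = γ ^ 2 / 4 * (N * (1 + ∫ ξ in (0 : ℝ)..1, S.θ ξ t)) := by
          rw [intervalIntegral.integral_const_mul, intervalIntegral.integral_const_mul,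
            intervalIntegral.integral_add (continuous_const.intervalIntegrable _ _)
              (Continuous.intervalIntegrable (by fun_prop) _ _)]
          simp
      _ ≤ _ := by
          gcongr
          exact S.integral_θ_le ht
  have hV := S.V_nonneg t
  have hsq : ∀ z, (S.θ z t ^ (γ / 2)) ^ 2 = S.θ z t ^ γ := by
    intro z
    rw [← rpow_natCast, ← rpow_mul (S.θ_pos z t).le]
    congr 1
    push_cast
    ring
  have h1 : S.θ y t ^ γ ≤ (S.E + 1) ^ γ := rpow_le_rpow (S.θ_pos y t).le hyE (by linarith)
  have h2 : S.θ x t ≤ 1 + S.θ x t ^ γ := by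
    have := (S.θ_pos x t)
    rcases le_total (S.θ x t) 1 with h | h
    · have : 0 < S.θ x t ^ γ := by positivity
      linarith
    · have := rpow_le_rpow_of_exponent_le h hγ1
      rw [rpow_one] at this
      linarith
  have h3 := hosc.trans (mul_le_mul_of_nonneg_left hW hV)
  have h4 : S.θ x t ≤ C₁ + C₂ * (S.V t * N) := by
    rw [hC₁, hC₂]
    linarith [sq_nonneg (S.θ x t ^ (γ / 2) - 2 * S.θ y t ^ (γ / 2)), hsq x, hsq y]
  have h5 : 0 ≤ S.V t * N := by positivity
  nlinarith [mul_nonneg hC₁0.le h5]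

/-- The velocity potential `φ(x,t) = ∫₀ˣ v`. -/
noncomputable def φ (x t : ℝ) : ℝ := ∫ ξ in (0 : ℝ)..x, S.v ξ t

theorem abs_φ_le {x t : ℝ} (hx : x ∈ Icc (0 : ℝ) 1) (ht : 0 ≤ t) : |S.φ x t| ≤ S.E + 1 / 2 := by
  have cv := S.cv
  exact S.abs_integral_le_of_abs_le_v (by fun_prop) ht (fun _ _ => le_rfl) hx

theorem continuous_φ (x : ℝ) : Continuous (S.φ x) := continuous_integral_param S.cv 0 x

theorem dφ_t {x t : ℝ} (hx : x ∈ Icc (0 : ℝ) 1) (ht : 0 < t) :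
    HasDerivAt (S.φ x) (S.σ x t) t := by
  have cσ := S.cσ
  have cvt := S.cvt
  refine (hasDerivAt_integral_param S.cv S.cvt 0 x S.dv_t ht).congr_deriv ?_
  rw [integral_eq_sub_of_continuous (F := fun x => S.σ x t) hx.1 (by fun_prop)
      (by fun_prop) fun y hy => S.dσ_x ⟨hy.1, hy.2.trans_le hx.2⟩ t]
  simp [S.σ_zero]

/-- Representation of the specific volume through the temperature. -/
theorem integral_exp_mul_θ {x a b : ℝ} (hx : x ∈ Icc (0 : ℝ) 1) (ha : 0 ≤ a) (hab : a ≤ b) :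
    ∫ s in a..b, exp (s - S.φ x s) * S.θ x s
      = exp (b - S.φ x b) * S.u x b - exp (a - S.φ x a) * S.u x a := by
  have cu := S.cu
  have cθ := S.cθ
  have cφ := S.continuous_φ x
  refine integral_eq_sub_of_continuous (F := fun s => exp (s - S.φ x s) * S.u x s) hab
    (by fun_prop) (by fun_prop) fun s hs => ?_
  have hs0 := ha.trans_lt hs.1
  refine ((((hasDerivAt_id s).fun_sub (S.dφ_t hx hs0)).exp).fun_mul (S.du_t x s hs0)).congr_deriv ?_
  rw [S.vx_eq]
  simp only [id]
  ring

theorem u_le_integral {x a b : ℝ} (hx : x ∈ Icc (0 : ℝ) 1) (ha : 0 ≤ a) (hab : a ≤ b) :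
    S.u x b ≤ exp (2 * S.E + 1) * (S.u x a + ∫ s in a..b, exp (s - b) * S.θ x s) := by
  have cθ := S.cθ
  have cφ := S.continuous_φ x
  have h := S.integral_exp_mul_θ hx ha hab
  have h1 : exp (a - S.φ x a) ≤ exp (S.E + 1 / 2) * exp b := by
    rw [← exp_add]
    exact exp_le_exp.2 (by linarith [(abs_le.1 (S.abs_φ_le hx ha)).1])
  have h2 : ∫ s in a..b, exp (s - S.φ x s) * S.θ x s
      ≤ exp (S.E + 1 / 2) * exp b * ∫ s in a..b, exp (s - b) * S.θ x s := by
    rw [← intervalIntegral.integral_const_mul]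
    refine intervalIntegral.integral_mono_on hab (Continuous.intervalIntegrable (by fun_prop) _ _)
      (Continuous.intervalIntegrable (by fun_prop) _ _) fun s hs => ?_
    rw [← mul_assoc, ← exp_add, ← exp_add]
    refine mul_le_mul_of_nonneg_right (exp_le_exp.2 ?_) (S.θ_pos x s).le
    linarith [(abs_le.1 (S.abs_φ_le hx (ha.trans hs.1))).1]
  have h3 : exp b ≤ exp (S.E + 1 / 2) * exp (b - S.φ x b) := by
    rw [← exp_add]
    exact exp_le_exp.2 (by linarith [(abs_le.1 (S.abs_φ_le hx (ha.trans hab))).2])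
  have h4 : exp (2 * S.E + 1) = exp (S.E + 1 / 2) * exp (S.E + 1 / 2) := by
    rw [← exp_add]; ring_nf
  have hua := S.u_pos x a
  have hub := S.u_pos x b
  refine le_of_mul_le_mul_left ?_ (exp_pos b)
  calc exp b * S.u x b ≤ exp (S.E + 1 / 2) * exp (b - S.φ x b) * S.u x b := by gcongr
    _ = exp (S.E + 1 / 2) * (exp (a - S.φ x a) * S.u x a
        + ∫ s in a..b, exp (s - S.φ x s) * S.θ x s) := by rw [h]; ring
    _ ≤ exp (S.E + 1 / 2) * (exp (S.E + 1 / 2) * exp b * S.u x a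
        + exp (S.E + 1 / 2) * exp b * ∫ s in a..b, exp (s - b) * S.θ x s) := by gcongr
    _ = _ := by rw [h4]; ring

theorem integral_le_u {x a b : ℝ} (hx : x ∈ Icc (0 : ℝ) 1) (ha : 0 ≤ a) (hab : a ≤ b) :
    exp (-(2 * S.E + 1) - (b - a)) * ∫ s in a..b, S.θ x s ≤ S.u x b := by
  have cθ := S.cθ
  have cφ := S.continuous_φ x
  have h := S.integral_exp_mul_θ hx ha hab
  have h2 : exp (a - (S.E + 1 / 2)) * ∫ s in a..b, S.θ x s
      ≤ ∫ s in a..b, exp (s - S.φ x s) * S.θ x s := by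
    rw [← intervalIntegral.integral_const_mul]
    refine intervalIntegral.integral_mono_on hab (Continuous.intervalIntegrable (by fun_prop) _ _)
      (Continuous.intervalIntegrable (by fun_prop) _ _) fun s hs => ?_
    refine mul_le_mul_of_nonneg_right (exp_le_exp.2 ?_) (S.θ_pos x s).le
    linarith [(abs_le.1 (S.abs_φ_le hx (ha.trans hs.1))).2, hs.1]
  have h3 : exp (b - S.φ x b) ≤ exp (b + (S.E + 1 / 2)) :=
    exp_le_exp.2 (by linarith [(abs_le.1 (S.abs_φ_le hx (ha.trans hab))).1])
  have h4 : exp (b + (S.E + 1 / 2)) * exp (-(2 * S.E + 1) - (b - a)) = exp (a - (S.E + 1 / 2)) := by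
    rw [← exp_add]; ring_nf
  have hub := S.u_pos x b
  have hua := mul_pos (exp_pos (a - S.φ x a)) (S.u_pos x a)
  refine le_of_mul_le_mul_left ?_ (exp_pos (b + (S.E + 1 / 2)))
  rw [← mul_assoc, h4]
  have := mul_le_mul_of_nonneg_right h3 hub.le
  linarith

/-- The specific volume is uniformly bounded. -/
theorem exists_u_le : ∃ N > 0, ∀ t ≥ (0 : ℝ), ∀ x ∈ Icc (0 : ℝ) 1, S.u x t ≤ N := by
  obtain ⟨C, hC, hθ⟩ := S.exists_θ_le_V_mul
  set K := exp (2 * S.E + 1) with hK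
  have hK0 : 0 < K := exp_pos _
  obtain ⟨T, hT, htail⟩ := S.exists_tail_le (η := 1 / (2 * K * C)) (by positivity)
  have cu := S.cu
  have cθ := S.cθ
  have cV := S.cV
  obtain ⟨N₀, hN₀⟩ := ((isCompact_Icc (a := (0 : ℝ)) (b := 1)).prod
    (isCompact_Icc (a := 0) (b := T))).exists_bound_of_continuousOn cu.continuousOn
  have hN₀' : ∀ x ∈ Icc (0 : ℝ) 1, ∀ t ∈ Icc 0 T, S.u x t ≤ N₀ := fun x hx t ht =>
    (le_abs_self _).trans (hN₀ (x, t) ⟨hx, ht⟩)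
  have hN₀0 : 0 < N₀ :=
    (S.u_pos 0 0).trans_le (hN₀' 0 (left_mem_Icc.2 zero_le_one) 0 (left_mem_Icc.2 hT))
  refine ⟨N₀ + 2 * (K * N₀ + K * C), by positivity, fun t ht x hx => ?_⟩
  have hKC : 0 < K * N₀ + K * C := by positivity
  rcases le_total t T with h | hTt
  · linarith [hN₀' x hx t ⟨ht, h⟩]
  obtain ⟨⟨x₁, t₁⟩, ⟨hx₁, ht₁⟩, hmax⟩ := ((isCompact_Icc (a := (0 : ℝ)) (b := 1)).prod
    (isCompact_Icc (a := T) (b := t))).exists_isMaxOn ⟨(x, t), hx, right_mem_Icc.2 hTt⟩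
      cu.continuousOn
  have hmax' : ∀ y ∈ Icc (0 : ℝ) 1, ∀ s ∈ Icc T t, S.u y s ≤ S.u x₁ t₁ := fun y hy s hs =>
    isMaxOn_iff.1 hmax (y, s) ⟨hy, hs⟩
  simp only at hx₁ ht₁
  set N := S.u x₁ t₁ with hN
  have hN0 : 0 < N := S.u_pos _ _
  have hrep := S.u_le_integral hx₁ hT ht₁.1
  have hexp : ∫ s in T..t₁, exp (s - t₁) ≤ 1 := by
    rw [integral_eq_sub_of_continuous (F := fun s => exp (s - t₁)) ht₁.1 (by fun_prop)
      (by fun_prop) fun s _ => (((hasDerivAt_id s).sub_const t₁).exp).congr_deriv (by simp)]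
    simp [(exp_pos (T - t₁)).le]
  have hint : ∫ s in T..t₁, exp (s - t₁) * S.θ x₁ s ≤ C + C * N * (1 / (2 * K * C)) := by
    calc ∫ s in T..t₁, exp (s - t₁) * S.θ x₁ s
        ≤ ∫ s in T..t₁, (C * exp (s - t₁) + C * N * S.V s) := by
          refine intervalIntegral.integral_mono_on ht₁.1
            (Continuous.intervalIntegrable (by fun_prop) _ _)
            (Continuous.intervalIntegrable (by fun_prop) _ _) fun s hs => ?_
          have h1 := hθ s (hT.trans hs.1) N hN0.le
            (fun y hy => hmax' y hy s ⟨hs.1, hs.2.trans ht₁.2⟩) x₁ hx₁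
          have h2 : exp (s - t₁) ≤ 1 := exp_le_one_iff.2 (by linarith [hs.2])
          have h3 : 0 ≤ C * N * S.V s := by have := S.V_nonneg s; positivity
          calc exp (s - t₁) * S.θ x₁ s ≤ exp (s - t₁) * (C + C * (S.V s * N)) := by gcongr
            _ = C * exp (s - t₁) + exp (s - t₁) * (C * N * S.V s) := by ring
            _ ≤ _ := by linarith [mul_le_of_le_one_left h3 h2]
      _ = C * (∫ s in T..t₁, exp (s - t₁)) + C * N * ∫ s in T..t₁, S.V s := by
          rw [intervalIntegral.integral_add (Continuous.intervalIntegrable (by fun_prop) _ _)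
            (Continuous.intervalIntegrable (by fun_prop) _ _),
            intervalIntegral.integral_const_mul, intervalIntegral.integral_const_mul]
      _ ≤ C * 1 + C * N * (1 / (2 * K * C)) := by
          gcongr
          exact htail T le_rfl t₁ ht₁.1
      _ = _ := by ring
  have h1 : K * (C * N * (1 / (2 * K * C))) = N / 2 := by field_simp
  have h2 : N ≤ K * (N₀ + (C + C * N * (1 / (2 * K * C)))) :=
    hrep.trans (mul_le_mul_of_nonneg_left
      (add_le_add (hN₀' x₁ hx₁ T (right_mem_Icc.2 hT)) hint) hK0.le)
  have h3 := hmax' x hx t (right_mem_Icc.2 hTt)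
  linarith

/-- At times of small dissipation the temperature is bounded away from zero. -/
theorem exists_le_θ_of_V_le : ∃ δ > 0, ∃ c > 0, ∀ t ≥ (0 : ℝ), S.V t ≤ δ →
    ∀ x ∈ Icc (0 : ℝ) 1, c ≤ S.θ x t := by
  obtain ⟨N, hN, hu⟩ := S.exists_u_le
  obtain ⟨c, hc, hθ⟩ := S.exists_le_θ
  have hβ := S.hβ
  have cu := S.cu
  set k := c ^ (S.β / 2) with hk
  have hk0 : 0 < k := by positivity
  refine ⟨k ^ 2 / (S.β ^ 2 * N), by positivity, (k / 2) ^ (2 / S.β), by positivity,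
    fun t ht hV x hx => ?_⟩
  obtain ⟨y, hy, hcy⟩ := hθ t ht
  have hosc := S.sq_sub_rpow_le S.β t hx hy
  simp only [sub_self, rpow_zero, mul_one] at hosc
  have hW : ∫ ξ in (0 : ℝ)..1, S.β ^ 2 / 4 * S.u ξ t ≤ S.β ^ 2 / 4 * N := by
    have := integral_unit_mono (f := fun ξ => S.β ^ 2 / 4 * S.u ξ t)
      (g := fun _ => S.β ^ 2 / 4 * N) (by fun_prop) continuous_const fun ξ hξ => by
        have := hu t ht ξ hξ
        gcongr
    simpa using this
  have h1 : (S.θ x t ^ (S.β / 2) - S.θ y t ^ (S.β / 2)) ^ 2 ≤ (k / 2) ^ 2 := by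
    calc _ ≤ k ^ 2 / (S.β ^ 2 * N) * (S.β ^ 2 / 4 * N) :=
          hosc.trans (mul_le_mul hV hW (intervalIntegral.integral_nonneg zero_le_one fun ξ _ =>
            mul_nonneg (by positivity) (S.u_pos ξ t).le) (by positivity))
      _ = _ := by field_simp; ring
  have h2 : k ≤ S.θ y t ^ (S.β / 2) := rpow_le_rpow hc.le hcy (by positivity)
  have h3 := (abs_le_of_sq_le_sq' h1 (by positivity)).1
  have h4 : k / 2 ≤ S.θ x t ^ (S.β / 2) := by linarith
  have h5 := rpow_le_rpow (z := 2 / S.β) (by positivity) h4 (by positivity)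
  rwa [← rpow_mul (S.θ_pos x t).le, show S.β / 2 * (2 / S.β) = 1 by field_simp, rpow_one] at h5

/-- The specific volume is eventually bounded away from zero. -/
theorem exists_le_u : ∃ T ≥ (0 : ℝ), ∃ c > 0, ∀ t ≥ T, ∀ x ∈ Icc (0 : ℝ) 1, c ≤ S.u x t := by
  obtain ⟨δ, hδ, c, hc, hθ⟩ := S.exists_le_θ_of_V_le
  obtain ⟨T, hT, htail⟩ := S.exists_tail_le (half_pos hδ)
  have cV := S.cV
  have cθ := S.cθ
  refine ⟨T + 1, by linarith, exp (-(2 * S.E + 1) - 1) * (c / 2), by positivity,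
    fun t ht x hx => ?_⟩
  have hrep := S.integral_le_u hx (show 0 ≤ t - 1 by linarith) (show t - 1 ≤ t by linarith)
  rw [show t - (t - 1) = 1 by ring] at hrep
  refine le_trans (mul_le_mul_of_nonneg_left ?_ (exp_pos _).le) hrep
  calc c / 2 = c * (1 - 1 / δ * (δ / 2)) := by field_simp; ring
    _ ≤ c * (1 - 1 / δ * ∫ s in (t - 1)..t, S.V s) := by
        gcongr
        exact htail (t - 1) (by linarith) t (by linarith)
    _ = ∫ s in (t - 1)..t, c * (1 - 1 / δ * S.V s) := by
        rw [intervalIntegral.integral_const_mul, intervalIntegral.integral_sub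
          (continuous_const.intervalIntegrable _ _)
          (Continuous.intervalIntegrable (by fun_prop) _ _), intervalIntegral.integral_const_mul]
        simp
    _ ≤ ∫ s in (t - 1)..t, S.θ x s := by
        refine intervalIntegral.integral_mono_on (by linarith)
            (Continuous.intervalIntegrable (by fun_prop) _ _)
            (Continuous.intervalIntegrable (by fun_prop) _ _) fun s hs => ?_
        rcases le_total (S.V s) δ with h | h
        · have h1 := hθ s (by linarith [hs.1]) h x hx
          have h2 : 0 ≤ 1 / δ * S.V s := by have := S.V_nonneg s; positivity
          nlinarith
        · have h1 : 1 ≤ 1 / δ * S.V s := by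
            rw [one_div, inv_mul_eq_div]
            exact (one_le_div hδ).2 h
          nlinarith [S.θ_pos x s]

/-- The asymptotic temperature. -/
noncomputable def A : ℝ := 2 * √(36 + 3 * (2 * S.E - S.m ^ 2)) - 12

theorem m_sq_le : S.m ^ 2 ≤ 2 * S.E := by
  have cv := S.cv
  have ce := S.continuous_energy_density 0
  have h : ∫ x in (0 : ℝ)..1, (S.m * S.v x 0 - S.m ^ 2 / 2)
      ≤ ∫ x in (0 : ℝ)..1, (S.v x 0 ^ 2 / 2 + S.θ x 0) :=
    integral_unit_mono (by fun_prop) ce fun x _ => by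
      nlinarith [sq_nonneg (S.v x 0 - S.m), S.θ_pos x 0]
  rw [intervalIntegral.integral_sub (Continuous.intervalIntegrable (by fun_prop) _ _)
    (continuous_const.intervalIntegrable _ _), intervalIntegral.integral_const_mul] at h
  have hm : S.m = ∫ x in (0 : ℝ)..1, S.v x 0 := rfl
  have hE : S.E = ∫ x in (0 : ℝ)..1, (S.v x 0 ^ 2 / 2 + S.θ x 0) := rfl
  rw [← hm, ← hE] at h
  simp only [intervalIntegral.integral_const, sub_zero, one_smul] at h
  nlinarith

theorem A_nonneg : 0 ≤ S.A := by
  have : (6 : ℝ) ≤ √(36 + 3 * (2 * S.E - S.m ^ 2)) :=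
    le_sqrt_of_sq_le (by linarith [S.m_sq_le])
  rw [A]
  linarith

theorem A_quadratic : S.A ^ 2 + 24 * S.A = 12 * (2 * S.E - S.m ^ 2) := by
  have := sq_sqrt (show 0 ≤ 36 + 3 * (2 * S.E - S.m ^ 2) by linarith [S.m_sq_le])
  rw [A]
  linarith

/-- At times of small dissipation the oscillation of the temperature is controlled by `V`. -/
theorem exists_sq_sub_le : ∃ δ > 0, ∃ L > 0, ∀ t ≥ (0 : ℝ), S.V t ≤ δ →
    ∀ x ∈ Icc (0 : ℝ) 1, ∀ y ∈ Icc (0 : ℝ) 1, (S.θ x t - S.θ y t) ^ 2 ≤ L * S.V t := by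
  obtain ⟨N, hN, hu⟩ := S.exists_u_le
  obtain ⟨δ, hδ, c, hc, hlow⟩ := S.exists_le_θ_of_V_le
  obtain ⟨C, hC, hup⟩ := S.exists_θ_le_V_mul
  have cu := S.cu
  obtain ⟨M, hM⟩ := (isCompact_Icc (a := c) (b := C + C * (δ * N))).exists_bound_of_continuousOn
    (f := fun s : ℝ => s ^ (2 - S.β))
    (continuousOn_id.rpow_const fun s hs => Or.inl (hc.trans_le hs.1).ne')
  refine ⟨δ, hδ, N * |M| + 1, by positivity, fun t ht hV x hx y hy => ?_⟩
  have hV0 := S.V_nonneg t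
  have hosc := S.sq_sub_rpow_le 2 t hx hy
  norm_num at hosc
  refine hosc.trans ?_
  rw [mul_comm]
  refine mul_le_mul_of_nonneg_right ?_ hV0
  have := integral_unit_mono (f := fun ξ => S.u ξ t * S.θ ξ t ^ (2 - S.β))
    (g := fun _ => N * |M|)
    (Continuous.mul (by fun_prop) (S.continuous_θ_rpow_slice _ t)) continuous_const fun ξ hξ => by
      have h1 := hu t ht ξ hξ
      have h2 := hM (S.θ ξ t) ⟨hlow t ht hV ξ hξ, (hup t ht N hN.le (hu t ht) ξ hξ).trans
        (by gcongr)⟩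
      have h3 : S.θ ξ t ^ (2 - S.β) ≤ |M| := (le_abs_self _).trans (h2.trans (le_abs_self M))
      have := S.u_pos ξ t
      have := S.θ_pos ξ t
      gcongr
  simp only [intervalIntegral.integral_const, sub_zero, one_smul] at this
  linarith

theorem abs_sub_integral_le {f : ℝ → ℝ} (hf : Continuous f) {a κ : ℝ}
    (h : ∀ y ∈ Icc (0 : ℝ) 1, |a - f y| ≤ κ) : |a - ∫ y in (0 : ℝ)..1, f y| ≤ κ := by
  have h1 := integral_unit_mono hf (continuous_const (y := a + κ)) fun y hy => by
    linarith [(abs_le.1 (h y hy)).1]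
  have h2 := integral_unit_mono (continuous_const (y := a - κ)) hf fun y hy => by
    linarith [(abs_le.1 (h y hy)).2]
  simp only [intervalIntegral.integral_const, sub_zero, one_smul] at h1 h2
  exact abs_le.2 ⟨by linarith, by linarith⟩

/-- Increments of `v - Θ x` are controlled by the dissipation and the oscillation of `θ`. -/
theorem sq_sub_v_le {t N R Θ : ℝ} (ht : 0 ≤ t) (hu : ∀ x ∈ Icc (0 : ℝ) 1, S.u x t ≤ N)
    (hΘ : ∀ x ∈ Icc (0 : ℝ) 1, (S.θ x t - Θ) ^ 2 ≤ R) {x y : ℝ} (hx : x ∈ Icc (0 : ℝ) 1)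
    (hy : y ∈ Icc (0 : ℝ) 1) :
    (S.v x t - Θ * x - (S.v y t - Θ * y)) ^ 2 ≤ (S.V t + R) * (N * S.E + 1) := by
  have cu := S.cu
  have cv := S.cv
  have cvx := S.cvx
  have cθ := S.cθ
  have cD := S.cD
  have hN : 0 ≤ N := (S.u_pos x t).le.trans (hu x hx)
  have hR : 0 ≤ R := (sq_nonneg _).trans (hΘ x hx)
  have h := sq_sub_le_of_sq_deriv_le (F := fun x => S.v x t - Θ * x) (F' := fun x => S.vx x t - Θ)
    (D := fun x => S.D x t + R) (W := fun x => N * S.θ x t + 1)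
    (by fun_prop) (by fun_prop) (by fun_prop) (by fun_prop)
    (fun x hx => ((S.dv_x x hx t).fun_sub ((hasDerivAt_id x).const_mul Θ)).congr_deriv (by simp))
    (fun x _ => add_nonneg (S.D_nonneg x t) hR)
    (fun x _ => by have := S.θ_pos x t; positivity) (fun x hx => ?_) hx hy
  · refine h.trans (le_of_eq_of_le ?_ (mul_le_mul_of_nonneg_left
      (add_le_add_left (mul_le_mul_of_nonneg_left (S.integral_θ_le ht) hN) 1)
      (add_nonneg (S.V_nonneg t) hR)))
    rw [intervalIntegral.integral_add (Continuous.intervalIntegrable (by fun_prop) _ _)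
      (continuous_const.intervalIntegrable _ _),
      intervalIntegral.integral_add (Continuous.intervalIntegrable (by fun_prop) _ _)
      (continuous_const.intervalIntegrable _ _), intervalIntegral.integral_const_mul]
    simp [V]
  · have h0 := S.u_pos x t
    have h1 := S.θ_pos x t
    set b := S.u x t * S.σ x t ^ 2 / S.θ x t with hb
    have hb0 : 0 ≤ b := S.viscous_part_nonneg x t
    have hDb : b ≤ S.D x t := by
      rw [D]
      linarith [S.thermal_part_nonneg x t]
    have hbθ : b * S.θ x t = S.u x t * S.σ x t ^ 2 := by
      rw [hb]
      field_simp
    have hR' := hΘ x hx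
    have huN := hu x hx
    set e := S.θ x t - Θ with he
    have hcross : 2 * (S.u x t * S.σ x t * e) ≤ b + S.u x t * S.θ x t * e ^ 2 := by
      have : b + S.u x t * S.θ x t * e ^ 2 - 2 * (S.u x t * S.σ x t * e)
          = S.u x t / S.θ x t * (S.σ x t - S.θ x t * e) ^ 2 := by
        rw [hb]
        field_simp
        ring
      have h2 : 0 ≤ S.u x t / S.θ x t * (S.σ x t - S.θ x t * e) ^ 2 := by positivity
      linarith
    have h3 : (S.vx x t - Θ) ^ 2 ≤ (b + e ^ 2) * (S.u x t * S.θ x t + 1) := by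
      have : S.vx x t - Θ = S.u x t * S.σ x t + e := by rw [S.vx_eq, he]; ring
      rw [this]
      linear_combination hcross - S.u x t * hbθ
    refine h3.trans ?_
    have := S.D_nonneg x t
    gcongr

/-- Near-equilibrium velocity profiles force the temperature level to be near `A`. -/
theorem abs_sub_A_le {t κ Θ : ℝ} (ht : 0 ≤ t) (hΘ : Θ = ∫ x in (0 : ℝ)..1, S.θ x t)
    (h : ∀ x ∈ Icc (0 : ℝ) 1, |S.v x t - (S.m + Θ * (x - 1 / 2))| ≤ κ) :
    |Θ - S.A| ≤ κ * (2 * S.E + 1 + κ) / 2 := by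
  have cv := S.cv
  have cθ := S.cθ
  have hκ : 0 ≤ κ := (abs_nonneg _).trans (h 0 (by simp))
  have hΘ0 : 0 ≤ Θ := hΘ ▸ intervalIntegral.integral_nonneg zero_le_one
    fun x _ => (S.θ_pos x t).le
  have hp : ∫ x in (0 : ℝ)..1, (S.m + Θ * (x - 1 / 2)) ^ 2 = S.m ^ 2 + Θ ^ 2 / 12 := by
    rw [integral_eq_sub_of_continuous
      (F := fun x => S.m ^ 2 * x + S.m * Θ * (x - 1 / 2) ^ 2 + Θ ^ 2 * (x - 1 / 2) ^ 3 / 3)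
      zero_le_one (by fun_prop) (by fun_prop) fun x _ => ?_]
    · ring
    · exact ((((hasDerivAt_id x).const_mul (S.m ^ 2)).fun_add
        ((((hasDerivAt_id x).sub_const (1 / 2)).fun_pow 2).const_mul (S.m * Θ))).fun_add
        (((((hasDerivAt_id x).sub_const (1 / 2)).fun_pow 3).const_mul (Θ ^ 2)).div_const
          3)).congr_deriv (by simp; ring)
  have hv : ∫ x in (0 : ℝ)..1, S.v x t ^ 2 = 2 * S.E - 2 * Θ := by
    rw [← S.integral_energy ht, hΘ,
      intervalIntegral.integral_add (Continuous.intervalIntegrable (by fun_prop) _ _)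
      (Continuous.intervalIntegrable (by fun_prop) _ _), intervalIntegral.integral_div]
    ring
  have hpt : ∀ x ∈ Icc (0 : ℝ) 1,
      |S.v x t ^ 2 - (S.m + Θ * (x - 1 / 2)) ^ 2| ≤ κ * (S.v x t ^ 2 + 1 + κ) := by
    intro x hx
    have h1 := h x hx
    set r := S.v x t - (S.m + Θ * (x - 1 / 2)) with hr
    have h2 : S.v x t ^ 2 - (S.m + Θ * (x - 1 / 2)) ^ 2 = r * (2 * S.v x t - r) := by
      rw [hr]
      ring
    rw [h2, abs_mul]
    refine mul_le_mul h1 ((abs_sub _ _).trans (add_le_add ?_ h1)) (abs_nonneg _) hκ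
    rw [abs_le]
    constructor <;> nlinarith [sq_nonneg (S.v x t - 1), sq_nonneg (S.v x t + 1)]
  have hmul : ∫ x in (0 : ℝ)..1, κ * (S.v x t ^ 2 + 1 + κ) ≤ κ * (2 * S.E + 1 + κ) := by
    rw [intervalIntegral.integral_const_mul,
      intervalIntegral.integral_add (Continuous.intervalIntegrable (by fun_prop) _ _)
      (continuous_const.intervalIntegrable _ _),
      intervalIntegral.integral_add (Continuous.intervalIntegrable (by fun_prop) _ _)
      (continuous_const.intervalIntegrable _ _), hv]
    simp only [intervalIntegral.integral_const, sub_zero, one_smul]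
    gcongr
    linarith
  have hsub := intervalIntegral.integral_sub (μ := volume) (a := 0) (b := 1)
    (f := fun x => S.v x t ^ 2) (g := fun x => (S.m + Θ * (x - 1 / 2)) ^ 2)
    (Continuous.intervalIntegrable (by fun_prop) _ _)
    (Continuous.intervalIntegrable (by fun_prop) _ _)
  rw [hv, hp] at hsub
  have hbound : |2 * S.E - 2 * Θ - (S.m ^ 2 + Θ ^ 2 / 12)| ≤ κ * (2 * S.E + 1 + κ) := by
    rw [← hsub]
    exact (intervalIntegral.abs_integral_le_integral_abs zero_le_one).trans
      ((integral_unit_mono (by fun_prop) (by fun_prop) hpt).trans hmul)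
  have hA := S.A_quadratic
  have hA0 := S.A_nonneg
  have hfac : |Θ - S.A| * (Θ + S.A + 24) = 12 * |2 * S.E - 2 * Θ - (S.m ^ 2 + Θ ^ 2 / 12)| := by
    rw [← abs_of_nonneg (show 0 ≤ Θ + S.A + 24 by linarith), ← abs_mul,
      ← abs_of_nonneg (show (0 : ℝ) ≤ 12 by norm_num), ← abs_mul, ← abs_neg]
    congr 1
    linear_combination hA
  nlinarith [abs_nonneg (Θ - S.A)]

/-- The temperature is close to `A` whenever the dissipation is small. -/
theorem exists_abs_sub_A_lt {ε : ℝ} (hε : 0 < ε) : ∃ δ > 0, ∀ t ≥ (0 : ℝ), S.V t ≤ δ →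
    ∀ x ∈ Icc (0 : ℝ) 1, |S.θ x t - S.A| < ε := by
  obtain ⟨N, hN, hu⟩ := S.exists_u_le
  obtain ⟨δ, hδ, L, hL, hosc⟩ := S.exists_sq_sub_le
  have hE := S.E_nonneg
  have cv := S.cv
  have cθ := S.cθ
  set κ := min 1 (ε / (2 * S.E + 4)) with hκ
  have hκ0 : 0 < κ := by positivity
  have hκ1 : κ ≤ 1 := min_le_left _ _
  have hκε : κ * (2 * S.E + 4) ≤ ε := (le_div_iff₀ (by positivity)).1 (min_le_right _ _)
  set K := (1 + L) * (N * S.E + 1) with hK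
  have hK0 : 0 < K := by positivity
  refine ⟨min δ (min (κ ^ 2 / L) (κ ^ 2 / K)), by positivity, fun t ht hV x hx => ?_⟩
  have hV0 := S.V_nonneg t
  have hVδ : S.V t ≤ δ := hV.trans (min_le_left _ _)
  have hVL : L * S.V t ≤ κ ^ 2 := by
    rw [mul_comm]
    exact (le_div_iff₀ hL).1 (hV.trans ((min_le_right _ _).trans (min_le_left _ _)))
  have hVK : K * S.V t ≤ κ ^ 2 := by
    rw [mul_comm]
    exact (le_div_iff₀ hK0).1 (hV.trans ((min_le_right _ _).trans (min_le_right _ _)))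
  set Θ := ∫ x in (0 : ℝ)..1, S.θ x t with hΘ
  have hθΘ : ∀ x ∈ Icc (0 : ℝ) 1, ∀ ρ ≥ 0, L * S.V t ≤ ρ ^ 2 → |S.θ x t - Θ| ≤ ρ :=
    fun x hx ρ hρ hle => abs_sub_integral_le (by fun_prop) fun y hy =>
      abs_le_of_sq_le_sq ((hosc t ht hVδ x hx y hy).trans hle) hρ
  have hsq : ∀ x ∈ Icc (0 : ℝ) 1, (S.θ x t - Θ) ^ 2 ≤ L * S.V t := fun x hx =>
    (sq_le_sq' (by
      linarith [(abs_le.1 (hθΘ x hx (√(L * S.V t)) (sqrt_nonneg _)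
        (sq_sqrt (by positivity)).ge)).1])
      (abs_le.1 (hθΘ x hx (√(L * S.V t)) (sqrt_nonneg _) (sq_sqrt (by positivity)).ge)).2).trans
      (sq_sqrt (by positivity)).le
  have hmean : ∫ y in (0 : ℝ)..1, (S.v y t - Θ * y) = S.m - Θ / 2 := by
    rw [intervalIntegral.integral_sub (Continuous.intervalIntegrable (by fun_prop) _ _)
      (Continuous.intervalIntegrable (by fun_prop) _ _), S.integral_v ht,
      intervalIntegral.integral_const_mul, integral_id]
    ring
  have hv : ∀ x ∈ Icc (0 : ℝ) 1, |S.v x t - (S.m + Θ * (x - 1 / 2))| ≤ κ := by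
    intro x hx
    have := abs_sub_integral_le (f := fun y => S.v y t - Θ * y) (a := S.v x t - Θ * x) (κ := κ)
      (by fun_prop) fun y hy => abs_le_of_sq_le_sq
        ((S.sq_sub_v_le ht (hu t ht) hsq hx hy).trans (le_trans (le_of_eq (by rw [hK]; ring)) hVK))
        hκ0.le
    rw [hmean] at this
    convert this using 2
    ring
  have h1 := S.abs_sub_A_le ht hΘ hv
  have h2 := hθΘ x hx κ hκ0.le hVL
  have h3 : κ * (2 * S.E + 1 + κ) ≤ κ * (2 * S.E + 1 + 1) := by gcongr
  have h4 := abs_sub_le (S.θ x t) Θ S.A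
  have h5 : 0 ≤ κ * S.E := by positivity
  nlinarith

end GlobalSol

/-- A function whose increments are bounded below by integrals of a kernel frozen at the initial
time is differentiable, with derivative the diagonal of the kernel. -/
theorem hasDerivAt_of_integral_le_sub {Y : ℝ → ℝ} {K : ℝ → ℝ → ℝ}
    (hK : Continuous (Function.uncurry K))
    (h : ∀ a > 0, ∀ b > 0, ∫ r in a..b, K r a ≤ Y b - Y a) {t : ℝ} (ht : 0 < t) :
    HasDerivAt Y (K t t) t := by
  rw [hasDerivAt_iff_isLittleO, Asymptotics.isLittleO_iff]
  intro ε hε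
  obtain ⟨δ, hδ, hball⟩ := Metric.continuousAt_iff.1 (hK.continuousAt (x := (t, t))) ε hε
  have key : ∀ a b, |a - t| < δ → |b - t| < δ → 0 < a → 0 < b →
      (b - a) * K t t - ε * |b - a| ≤ Y b - Y a := by
    intro a b ha hb ha0 hb0
    have hint : |(∫ r in a..b, K r a) - (b - a) * K t t| ≤ ε * |b - a| := by
      have cK : Continuous fun r => K r a := by fun_prop
      have : (∫ r in a..b, K r a) - (b - a) * K t t = ∫ r in a..b, (K r a - K t t) := by
        rw [intervalIntegral.integral_sub (cK.intervalIntegrable _ _)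
          (continuous_const.intervalIntegrable _ _)]
        simp
      rw [this]
      refine intervalIntegral.norm_integral_le_of_norm_le_const (f := fun r => K r a - K t t)
        fun r hr => ?_
      have hr' : |r - t| < δ := by
        rw [abs_lt] at *
        rcases le_total a b with hab | hab
        · rw [uIoc_of_le hab] at hr
          constructor <;> linarith [hr.1, hr.2]
        · rw [uIoc_of_ge hab] at hr
          constructor <;> linarith [hr.1, hr.2]
      have := @hball (r, a) (by
        rw [Prod.dist_eq, max_lt_iff]
        exact ⟨hr', ha⟩)
      exact this.le
    linarith [(abs_le.1 hint).1, h a ha0 b hb0]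
  filter_upwards [Metric.ball_mem_nhds t hδ, lt_mem_nhds ht] with b hb hb0
  have hb' : |b - t| < δ := hb
  have h0 : |t - t| < δ := by simpa using hδ
  have h1 := key t b h0 hb' ht hb0
  have h2 := key b t hb' h0 hb0 ht
  rw [abs_sub_comm t b] at h2
  rw [smul_eq_mul, norm_eq_abs, norm_eq_abs, abs_le]
  constructor <;> linarith

namespace GlobalSol

variable (S : GlobalSol)

/-- The weighted square norm of the stress. -/
noncomputable def Y (t : ℝ) : ℝ := ∫ x in (0 : ℝ)..1, S.u x t * S.σ x t ^ 2

/-- The square norm of the acceleration. -/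
noncomputable def Z (t : ℝ) : ℝ := ∫ x in (0 : ℝ)..1, S.vt x t ^ 2

theorem cY : Continuous S.Y :=
  continuous_integral_param (f := fun x t => S.u x t * S.σ x t ^ 2) (S.cu.fun_mul (S.cσ.fun_pow 2)) 0 1

theorem cZ : Continuous S.Z :=
  continuous_integral_param (f := fun x t => S.vt x t ^ 2) (S.cvt.fun_pow 2) 0 1

theorem Y_nonneg (t : ℝ) : 0 ≤ S.Y t :=
  intervalIntegral.integral_nonneg zero_le_one fun x _ =>
    mul_nonneg (S.u_pos x t).le (sq_nonneg _)

theorem Z_nonneg (t : ℝ) : 0 ≤ S.Z t :=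
  intervalIntegral.integral_nonneg zero_le_one fun _ _ => sq_nonneg _

theorem σ_sq_le (t : ℝ) {x : ℝ} (hx : x ∈ Icc (0 : ℝ) 1) : S.σ x t ^ 2 ≤ S.Z t := by
  have cσ := S.cσ
  have cvt := S.cvt
  have h := sq_sub_le_of_sq_deriv_le (F := fun x => S.σ x t) (F' := fun x => S.vt x t)
    (D := fun x => S.vt x t ^ 2) (W := fun _ => 1) (by fun_prop) (by fun_prop) (by fun_prop)
    (by fun_prop) (fun x hx => S.dσ_x hx t) (fun _ _ => sq_nonneg _) (fun _ _ => zero_le_one)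
    (fun _ _ => (mul_one _).ge) hx (left_mem_Icc.2 zero_le_one)
  simpa [S.σ_zero, Z] using h

/-- Weak form of the time derivative of `Y`, tested with the stress at time `r`. -/
noncomputable def stressKernel (t r : ℝ) : ℝ :=
  ∫ x in (0 : ℝ)..1, (-2 * S.vt x t * S.vt x r - 2 * S.θt x t * S.σ x r
    - (S.vx x t - S.u x t) * S.σ x r ^ 2)

theorem continuous_stressKernel : Continuous (Function.uncurry S.stressKernel) := by
  have cσ := S.cσ
  have cvt := S.cvt
  have cθt := S.cθt
  have cvx := S.cvx
  have cu := S.cu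
  exact intervalIntegral.continuous_parametric_intervalIntegral_of_continuous'
    (f := fun (p : ℝ × ℝ) x => -2 * S.vt x p.1 * S.vt x p.2 - 2 * S.θt x p.1 * S.σ x p.2
      - (S.vx x p.1 - S.u x p.1) * S.σ x p.2 ^ 2) (by fun_prop) 0 1

theorem integral_stressKernel_le {a b : ℝ} (ha : 0 < a) (hb : 0 < b) :
    ∫ t in a..b, S.stressKernel t a ≤ S.Y b - S.Y a := by
  have cσ := S.cσ
  have cvt := S.cvt
  have cθt := S.cθt
  have cvx := S.cvx
  have cu := S.cu
  have cv := S.cv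
  have cθ := S.cθ
  set G : ℝ → ℝ := fun t => ∫ x in (0 : ℝ)..1, (-2 * S.v x t * S.vt x a - 2 * S.θ x t * S.σ x a
    - S.u x t * S.σ x a ^ 2) with hG
  have hGd : ∀ t > 0, HasDerivAt G (S.stressKernel t a) t := fun t ht =>
    hasDerivAt_integral_param
      (f := fun x t => -2 * S.v x t * S.vt x a - 2 * S.θ x t * S.σ x a - S.u x t * S.σ x a ^ 2)
      (ft := fun x t => -2 * S.vt x t * S.vt x a - 2 * S.θt x t * S.σ x a
        - (S.vx x t - S.u x t) * S.σ x a ^ 2) (by fun_prop) (by fun_prop) 0 1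
      (fun x t ht => (((((S.dv_t x t ht).const_mul (-2)).mul_const (S.vt x a)).fun_sub
        (((S.dθ_t x t ht).const_mul 2).mul_const (S.σ x a))).fun_sub
        ((S.du_t x t ht).mul_const (S.σ x a ^ 2)))) ht
  have hcK : Continuous fun t => S.stressKernel t a :=
    S.continuous_stressKernel.comp (continuous_id.prodMk continuous_const)
  have hFTC : ∫ t in a..b, S.stressKernel t a = G b - G a :=
    intervalIntegral.integral_eq_sub_of_hasDerivAt
      (fun t ht => hGd t ((lt_min ha hb).trans_le ht.1)) (hcK.intervalIntegrable _ _)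
  have hGeq : ∀ t, G t = ∫ x in (0 : ℝ)..1, (2 * (S.u x t * S.σ x t) * S.σ x a
      - S.u x t * S.σ x a ^ 2) := by
    intro t
    rw [← sub_eq_zero, hG]
    dsimp only
    rw [← intervalIntegral.integral_sub (Continuous.intervalIntegrable (by fun_prop) _ _)
      (Continuous.intervalIntegrable (by fun_prop) _ _),
      integral_eq_sub_of_continuous (F := fun x => -2 * (S.v x t * S.σ x a)) zero_le_one
        (by fun_prop) (by fun_prop) fun x hx =>
          (((S.dv_x x hx t).fun_mul (S.dσ_x hx a)).const_mul (-2)).congr_deriv (by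
            rw [S.vx_eq]
            ring)]
    simp [S.σ_zero, S.σ_one]
  have hGa : G a = S.Y a := by
    rw [hGeq, Y]
    congr 1
    ext x
    ring
  have hGb : G b ≤ S.Y b := by
    rw [hGeq, Y]
    refine integral_unit_mono (by fun_prop) (by fun_prop) fun x _ => ?_
    have := mul_nonneg (S.u_pos x b).le (sq_nonneg (S.σ x b - S.σ x a))
    linarith
  linarith

theorem stressKernel_diag (t : ℝ) : S.stressKernel t t =
    ∫ x in (0 : ℝ)..1, (-2 * S.vt x t ^ 2 + 2 * S.q x t * S.vt x t
      - (3 * S.θ x t - S.u x t + 3 * (S.u x t * S.σ x t)) * S.σ x t ^ 2) := by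
  have cσ := S.cσ
  have cvt := S.cvt
  have cθt := S.cθt
  have cvx := S.cvx
  have cu := S.cu
  have cθ := S.cθ
  have cq := S.cq
  rw [← sub_eq_zero, stressKernel,
    ← intervalIntegral.integral_sub (Continuous.intervalIntegrable (by fun_prop) _ _)
      (Continuous.intervalIntegrable (by fun_prop) _ _),
    integral_eq_sub_of_continuous (F := fun x => -2 * (S.q x t * S.σ x t)) zero_le_one
      (by fun_prop) (by fun_prop) fun x hx =>
        (((S.dq_x hx t).fun_mul (S.dσ_x hx t)).const_mul (-2)).congr_deriv (by
          rw [qx, S.vx_eq]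
          ring)]
  simp [S.σ_zero, S.σ_one]

theorem dY {t : ℝ} (ht : 0 < t) : HasDerivAt S.Y (S.stressKernel t t) t :=
  hasDerivAt_of_integral_le_sub S.continuous_stressKernel
    (fun _ ha _ hb => S.integral_stressKernel_le ha hb) ht

theorem Y_le {t B : ℝ} (hB : ∀ x ∈ Icc (0 : ℝ) 1, S.θ x t ≤ B) : S.Y t ≤ B * S.V t := by
  have cσ := S.cσ
  have cu := S.cu
  have cD := S.cD
  rw [V, ← intervalIntegral.integral_const_mul]
  refine integral_unit_mono (by fun_prop) (by fun_prop) fun x hx => ?_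
  have h1 := S.θ_pos x t
  have h2 : S.u x t * S.σ x t ^ 2 / S.θ x t ≤ S.D x t := by
    rw [D]
    linarith [S.thermal_part_nonneg x t]
  calc S.u x t * S.σ x t ^ 2 = S.θ x t * (S.u x t * S.σ x t ^ 2 / S.θ x t) := by field_simp
    _ ≤ B * S.D x t := mul_le_mul (hB x hx) h2 (S.viscous_part_nonneg x t)
      (h1.le.trans (hB x hx))

theorem integral_q_sq_le {t B c : ℝ} (hc : 0 < c) (hu : ∀ x ∈ Icc (0 : ℝ) 1, c ≤ S.u x t)
    (hB : ∀ x ∈ Icc (0 : ℝ) 1, S.θ x t ≤ B) :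
    ∫ x in (0 : ℝ)..1, S.q x t ^ 2 ≤ B ^ S.β / c * B ^ 2 * S.V t := by
  have cq := S.cq
  have cD := S.cD
  have hβ := S.hβ
  rw [V, ← intervalIntegral.integral_const_mul]
  refine integral_unit_mono (by fun_prop) (by fun_prop) fun x hx => ?_
  have h1 := S.θ_pos x t
  have h0 := S.u_pos x t
  have hBx := hB x hx
  have hB0 : 0 < B := h1.trans_le hBx
  set d := S.θ x t ^ S.β / S.u x t * S.θx x t ^ 2 / S.θ x t ^ 2 with hd
  have h2 : d ≤ S.D x t := by
    rw [D]
    linarith [S.viscous_part_nonneg x t]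
  have hd0 : 0 ≤ d := S.thermal_part_nonneg x t
  calc S.q x t ^ 2 = S.θ x t ^ S.β / S.u x t * S.θ x t ^ 2 * d := by
        rw [hd, q]
        field_simp
    _ ≤ B ^ S.β / c * B ^ 2 * S.D x t := by
        have := hu x hx
        gcongr

/-- Differential inequality for `Y`. -/
theorem stressKernel_diag_le {t B c : ℝ} (hc : 0 < c) (hu : ∀ x ∈ Icc (0 : ℝ) 1, c ≤ S.u x t)
    (hB : ∀ x ∈ Icc (0 : ℝ) 1, S.θ x t ≤ B) :
    S.stressKernel t t ≤ (B ^ S.β / c * B ^ 2 + 9 * B) * S.V t * (1 + S.Y t) - S.Z t / 2 := by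
  have cσ := S.cσ
  have cvt := S.cvt
  have cu := S.cu
  have cθ := S.cθ
  have cq := S.cq
  have hZ := S.Z_nonneg t
  have hV := S.V_nonneg t
  have hY := S.Y_nonneg t
  have hB0 : 0 < B := (S.θ_pos 0 t).trans_le (hB 0 (by simp))
  set M := √(S.Z t) with hM
  have hM2 : M ^ 2 = S.Z t := sq_sqrt hZ
  have h1 : S.stressKernel t t ≤ ∫ x in (0 : ℝ)..1,
      (-(S.vt x t ^ 2) + S.q x t ^ 2 + (1 + 3 * M) * (S.u x t * S.σ x t ^ 2)) := by
    rw [S.stressKernel_diag]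
    refine integral_unit_mono (by fun_prop) (by fun_prop) fun x hx => ?_
    have h0 := S.u_pos x t
    have h2 := S.θ_pos x t
    have h3 : -M ≤ S.σ x t := by
      have := abs_le_of_sq_le_sq ((S.σ_sq_le t hx).trans hM2.ge) (sqrt_nonneg _)
      exact (abs_le.1 this).1
    have h4 : 0 ≤ S.u x t * S.σ x t ^ 2 * (S.σ x t + M) :=
      mul_nonneg (by positivity) (by linarith)
    have h5 : 0 ≤ S.θ x t * S.σ x t ^ 2 := by positivity
    nlinarith [sq_nonneg (S.vt x t - S.q x t)]
  rw [intervalIntegral.integral_add (Continuous.intervalIntegrable (by fun_prop) _ _)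
      (Continuous.intervalIntegrable (by fun_prop) _ _),
    intervalIntegral.integral_add (Continuous.intervalIntegrable (by fun_prop) _ _)
      (Continuous.intervalIntegrable (by fun_prop) _ _), intervalIntegral.integral_neg,
    intervalIntegral.integral_const_mul] at h1
  change S.stressKernel t t ≤ -S.Z t + _ + (1 + 3 * M) * S.Y t at h1
  have h2 := S.integral_q_sq_le hc hu hB
  have h3 := S.Y_le hB
  have h4 : 3 * M * S.Y t ≤ S.Z t / 2 + 9 / 2 * S.Y t ^ 2 := by
    nlinarith [sq_nonneg (M - 3 * S.Y t)]
  have h5 : 0 ≤ B ^ S.β / c * B ^ 2 * S.V t * S.Y t := by positivity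
  have h6 : S.Y t ^ 2 ≤ B * S.V t * S.Y t := by nlinarith
  have h7 : 0 ≤ B * S.V t := by positivity
  nlinarith [mul_nonneg h7 hY]

/-- While the temperature stays bounded, the total acceleration is controlled by the dissipation. -/
theorem exists_integral_Z_le {B c : ℝ} (hB : 0 < B) (hc : 0 < c) : ∃ C > 0, ∀ η ≤ (1 : ℝ),
    ∀ s ≥ (0 : ℝ), ∀ τ ≥ s, (∀ t ∈ Icc s τ, ∀ x ∈ Icc (0 : ℝ) 1, c ≤ S.u x t ∧ S.θ x t ≤ B) →
    S.V s ≤ η → ∫ t in s..τ, S.V t ≤ η → ∫ t in s..τ, S.Z t ≤ C * η := by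
  have cV := S.cV
  have cZ := S.cZ
  have cY := S.cY
  have hβ := S.hβ
  set k := B ^ S.β / c * B ^ 2 + 9 * B with hk
  have hk0 : 0 < k := by positivity
  refine ⟨2 * (B + k * ((1 + B) * exp k)), by positivity, fun η hη s hs τ hτ hb hVs hVint => ?_⟩
  have hη0 : 0 ≤ η := (S.V_nonneg s).trans hVs
  set I : ℝ → ℝ := fun t => ∫ r in s..t, S.V r with hI
  have dI : ∀ t, HasDerivAt I (S.V t) t := fun t => cV.integral_hasStrictDerivAt s t |>.hasDerivAt
  have cI : Continuous I := continuous_iff_continuousAt.2 fun t => (dI t).continuousAt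
  have hIs : I s = 0 := intervalIntegral.integral_same
  have hmono : ∀ t ∈ Icc s τ, I t ≤ η := fun t ht =>
    (intervalIntegral.integral_mono_interval le_rfl ht.1 ht.2
      (Eventually.of_forall fun r => S.V_nonneg r) (cV.intervalIntegrable _ _)).trans hVint
  have hin : ∀ t ∈ Ioo s τ, S.stressKernel t t ≤ k * S.V t * (1 + S.Y t) - S.Z t / 2 :=
    fun t ht => S.stressKernel_diag_le hc (fun x hx => (hb t (Ioo_subset_Icc_self ht) x hx).1)
      fun x hx => (hb t (Ioo_subset_Icc_self ht) x hx).2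
  have hYs : S.Y s ≤ B * η := (S.Y_le fun x hx => (hb s (left_mem_Icc.2 hτ) x hx).2).trans
    (by gcongr)
  have hYbound : ∀ t ∈ Icc s τ, 1 + S.Y t ≤ (1 + B) * exp k := by
    intro t ht
    have h1 := le_of_hasDerivAt_nonpos (F := fun r => exp (-(k * I r)) * (1 + S.Y r)) ht.1
      (by fun_prop) (fun r hr => ((((dI r).const_mul k).fun_neg.exp).fun_mul
        ((S.dY (hs.trans_lt hr.1)).const_add 1))) fun r hr => by
          have := hin r ⟨hr.1, hr.2.trans_le ht.2⟩
          have hZ := S.Z_nonneg r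
          have he := exp_pos (-(k * I r))
          have : exp (-(k * I r)) * (S.stressKernel r r - k * S.V r * (1 + S.Y r)) ≤ 0 :=
            mul_nonpos_of_nonneg_of_nonpos he.le (by linarith)
          linarith
    simp only [hIs, mul_zero, neg_zero, exp_zero, one_mul] at h1
    have h2 : exp (-k) ≤ exp (-(k * I t)) := by
      rw [exp_le_exp]
      nlinarith [hmono t ht]
    have h3 : exp (-k) * (1 + S.Y t) ≤ 1 + B := by
      have := S.Y_nonneg t
      calc exp (-k) * (1 + S.Y t) ≤ exp (-(k * I t)) * (1 + S.Y t) := by gcongr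
        _ ≤ 1 + S.Y s := h1
        _ ≤ 1 + B := by nlinarith
    rw [exp_neg, inv_mul_le_iff₀ (exp_pos k)] at h3
    linarith
  set J : ℝ → ℝ := fun t => ∫ r in s..t, S.Z r with hJ
  have dJ : ∀ t, HasDerivAt J (S.Z t) t := fun t => cZ.integral_hasStrictDerivAt s t |>.hasDerivAt
  have cJ : Continuous J := continuous_iff_continuousAt.2 fun t => (dJ t).continuousAt
  have hJs : J s = 0 := intervalIntegral.integral_same
  have h1 := le_of_hasDerivAt_nonpos
    (F := fun r => S.Y r + J r / 2 - k * ((1 + B) * exp k) * I r) hτ (by fun_prop)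
    (fun r hr => ((S.dY (hs.trans_lt hr.1)).fun_add ((dJ r).div_const 2)).fun_sub
      ((dI r).const_mul _)) fun r hr => by
        have h2 := hin r hr
        have h3 := hYbound r (Ioo_subset_Icc_self hr)
        have h4 := mul_le_mul_of_nonneg_left h3 (mul_nonneg hk0.le (S.V_nonneg r))
        linarith
  simp only [hIs, hJs] at h1
  have h2 := S.Y_nonneg τ
  have h3 : k * ((1 + B) * exp k) * I τ ≤ k * ((1 + B) * exp k) * η := by gcongr
  change J τ ≤ _
  linarith

/-- Barrier estimate for the temperature on a short time interval. -/
theorem abs_sub_lt_of_barrier {s τ N B κ ζ ε a : ℝ} (hs : 0 ≤ s) (hτ : s ≤ τ) (hτ1 : τ ≤ s + 1)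
    (hκ : 0 < κ) (hu : ∀ t ∈ Icc s τ, ∀ x ∈ Icc (0 : ℝ) 1, S.u x t ≤ N)
    (hB : ∀ t ∈ Icc s τ, ∀ x ∈ Icc (0 : ℝ) 1, S.θ x t ≤ B)
    (hZ : ∫ t in s..τ, S.Z t ≤ ζ) (hinit : ∀ x ∈ Icc (0 : ℝ) 1, |S.θ x s - a| < ε)
    {x : ℝ} (hx : x ∈ Icc (0 : ℝ) 1) :
    |S.θ x τ - a| < ε + ((N + B / κ) * ζ + B * κ) := by
  have cZ := S.cZ
  have hB0 : 0 < B := (S.θ_pos 0 s).trans_le (hB s (left_mem_Icc.2 hτ) 0 (by simp))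
  have hN0 : 0 < N := (S.u_pos 0 s).trans_le (hu s (left_mem_Icc.2 hτ) 0 (by simp))
  set J : ℝ → ℝ := fun t => (N + B / κ) * (∫ r in s..t, S.Z r) + B * κ * (t - s) with hJ
  have dJ : ∀ t, HasDerivAt J ((N + B / κ) * S.Z t + B * κ) t := fun t =>
    (((cZ.integral_hasStrictDerivAt s t).hasDerivAt.const_mul _).fun_add
      (((hasDerivAt_id t).sub_const s).const_mul (B * κ))).congr_deriv (by simp)
  have hJs : J s = 0 := by simp [hJ]
  have hJτ : J τ ≤ (N + B / κ) * ζ + B * κ := by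
    have h1 : B * κ * (τ - s) ≤ B * κ * 1 := by
      gcongr
      linarith
    have h2 : (N + B / κ) * (∫ r in s..τ, S.Z r) ≤ (N + B / κ) * ζ := by gcongr
    simp only [hJ]
    linarith
  have hsource : ∀ t ∈ Ioc s τ, ∀ y ∈ Icc (0 : ℝ) 1,
      |S.vx y t * S.σ y t| < (N + B / κ) * S.Z t + B * κ := by
    intro t ht y hy
    have ht' := Ioc_subset_Icc_self ht
    have h0 := S.u_pos y t
    have h1 := S.θ_pos y t
    have h2 := S.σ_sq_le t hy
    have h3 := hu t ht' y hy
    have h4 := hB t ht' y hy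
    have hZ0 := S.Z_nonneg t
    have h5 : |S.σ y t| < κ + S.Z t / κ := by
      have : |S.σ y t| * κ < κ ^ 2 + S.Z t := by
        nlinarith [sq_abs (S.σ y t), sq_nonneg (|S.σ y t| - κ), abs_nonneg (S.σ y t)]
      rw [← mul_lt_mul_iff_left₀ hκ]
      calc _ < _ := this
        _ = _ := by field_simp
    calc |S.vx y t * S.σ y t| = |S.u y t * S.σ y t ^ 2 + S.θ y t * S.σ y t| := by
          rw [S.vx_eq]
          congr 1
          ring
      _ ≤ S.u y t * S.σ y t ^ 2 + S.θ y t * |S.σ y t| := by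
          refine (abs_add_le _ _).trans (le_of_eq ?_)
          rw [abs_of_nonneg (by positivity), abs_mul, abs_of_pos h1]
      _ < N * S.Z t + B * (κ + S.Z t / κ) := by
          refine add_lt_add_of_le_of_lt (by gcongr) ?_
          calc S.θ y t * |S.σ y t| ≤ B * |S.σ y t| := by gcongr
            _ < _ := by gcongr
      _ = _ := by ring
  have hupper := lt_of_parabolic (f := S.θ) (ft := S.θt) (fx := S.θx)
    (a := fun y t => S.θ y t ^ S.β / S.u y t) (qx := S.qx) (z := fun t => a + ε + J t)
    S.cθ S.cθx S.continuous_conductivity S.cqx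
    (fun y t => div_pos (rpow_pos_of_pos (S.θ_pos y t) _) (S.u_pos y t)) S.dθ_x
    (fun y hy t => S.dq_x hy t) S.θx_zero S.θx_one
    (fun y t ht => S.dθ_t y t (hs.trans_lt ht)) (fun t => (dJ t).const_add (a + ε))
    (fun t ht y hy => by
      rw [qx]
      linarith [(abs_lt.1 (hsource t ht y hy)).2])
    (fun y hy => by
      rw [hJs]
      linarith [(abs_lt.1 (hinit y hy)).2]) hx (right_mem_Icc.2 hτ)
  have hlower := lt_of_parabolic (f := fun y t => -S.θ y t) (ft := fun y t => -S.θt y t)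
    (fx := fun y t => -S.θx y t)
    (a := fun y t => S.θ y t ^ S.β / S.u y t) (qx := fun y t => -S.qx y t)
    (z := fun t => -a + ε + J t)
    S.cθ.neg S.cθx.neg S.continuous_conductivity S.cqx.neg
    (fun y t => div_pos (rpow_pos_of_pos (S.θ_pos y t) _) (S.u_pos y t))
    (fun y hy t => (S.dθ_x y hy t).fun_neg)
    (fun y hy t => by
      simp only [mul_neg]
      exact (S.dq_x hy t).fun_neg)
    (fun t => by simp [S.θx_zero]) (fun t => by simp [S.θx_one])
    (fun y t ht => (S.dθ_t y t (hs.trans_lt ht)).fun_neg) (fun t => (dJ t).const_add (-a + ε))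
    (fun t ht y hy => by
      rw [qx]
      linarith [(abs_lt.1 (hsource t ht y hy)).1])
    (fun y hy => by
      rw [hJs]
      linarith [(abs_lt.1 (hinit y hy)).1]) hx (right_mem_Icc.2 hτ)
  rw [abs_lt]
  constructor <;> linarith

theorem exists_abs_sub_A_lt_forward {ε : ℝ} (hε : 0 < ε) : ∃ T ≥ (0 : ℝ), ∃ δ > 0, ∀ s ≥ T,
    S.V s ≤ δ → ∀ t ∈ Icc s (s + 1), ∀ x ∈ Icc (0 : ℝ) 1, |S.θ x t - S.A| < ε := by
  obtain ⟨N, hN, hu⟩ := S.exists_u_le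
  obtain ⟨T₁, hT₁, c, hc, hlow⟩ := S.exists_le_u
  set B := S.A + 1 with hB
  have hB0 : 0 < B := by linarith [S.A_nonneg]
  obtain ⟨C, hC, hZ⟩ := S.exists_integral_Z_le hB0 hc
  set ρ := min ε 1 / 3 with hρ
  have hρ0 : 0 < ρ := by positivity
  have hρε : 3 * ρ ≤ ε := by linarith [min_le_left ε 1]
  have hρ1 : 3 * ρ ≤ 1 := by linarith [min_le_right ε 1]
  obtain ⟨δ, hδ, hclose⟩ := S.exists_abs_sub_A_lt hρ0
  set κ := ρ / B with hκ
  have hκ0 : 0 < κ := by positivity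
  set η := min 1 (ρ / ((N + B / κ) * C)) with hη
  have hη0 : 0 < η := by positivity
  have hηρ : (N + B / κ) * (C * η) ≤ ρ := by
    rw [← mul_assoc, mul_comm]
    exact (le_div_iff₀ (by positivity)).1 (min_le_right _ _)
  have hBκ : B * κ = ρ := by
    rw [hκ]
    field_simp
  obtain ⟨T₂, hT₂, htail⟩ := S.exists_tail_le hη0
  refine ⟨max T₁ T₂, hT₁.trans (le_max_left _ _), min δ η, by positivity, fun s hs hVs => ?_⟩
  have hs1 : T₁ ≤ s := (le_max_left _ _).trans hs
  have hs2 : T₂ ≤ s := (le_max_right _ _).trans hs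
  have hs0 : 0 ≤ s := hT₁.trans hs1
  have hinit := hclose s hs0 (hVs.trans (min_le_left _ _))
  have hstep : ∀ τ ∈ Icc s (s + 1), (∀ t ∈ Icc s τ, ∀ x ∈ Icc (0 : ℝ) 1, S.θ x t ≤ B) →
      ∀ x ∈ Icc (0 : ℝ) 1, |S.θ x τ - S.A| < 3 * ρ := by
    intro τ hτ hθ x hx
    have h := S.abs_sub_lt_of_barrier hs0 hτ.1 hτ.2 hκ0
      (fun t ht => hu t (hs0.trans ht.1)) hθ
      (hZ η (min_le_left _ _) s hs0 τ hτ.1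
        (fun t ht y hy => ⟨hlow t (hs1.trans ht.1) y hy, hθ t ht y hy⟩)
        (hVs.trans (min_le_right _ _)) (htail s hs2 τ hτ.1)) hinit hx
    linarith
  have hbelow : ∀ t ∈ Icc s (s + 1), ∀ x ∈ Icc (0 : ℝ) 1, S.θ x t < B := by
    by_contra! hcon
    obtain ⟨t, ht, x, hx, hle⟩ := hcon
    obtain ⟨x₁, hx₁, t₁, ht₁, heq, hbefore, hat⟩ := exists_first_contact S.cθ
      (continuous_const (y := B)) (fun y hy => by
        linarith [(abs_lt.1 (hinit y hy)).2]) ⟨x, hx, t, ht, hle⟩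
    have h := hstep t₁ (Ioc_subset_Icc_self ht₁) (fun r hr y hy => by
      rcases hr.2.eq_or_lt with h | h
      · rw [h]
        exact hat y hy
      · exact (hbefore y hy r ⟨hr.1, h⟩).le) x₁ hx₁
    linarith [(abs_lt.1 h).2]
  intro t ht x hx
  exact (hstep t ht (fun r hr y hy => (hbelow r ⟨hr.1, hr.2.trans ht.2⟩ y hy).le) x hx).trans_le
    hρε

/-- The temperature converges uniformly to `A`. -/
theorem eventually_abs_sub_A_lt {ε : ℝ} (hε : 0 < ε) :
    ∃ T ≥ (0 : ℝ), ∀ t ≥ T, ∀ x ∈ Icc (0 : ℝ) 1, |S.θ x t - S.A| < ε := by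
  obtain ⟨T₁, hT₁, δ, hδ, hfwd⟩ := S.exists_abs_sub_A_lt_forward hε
  obtain ⟨T₂, hT₂, htail⟩ := S.exists_tail_le (half_pos hδ)
  refine ⟨max T₁ T₂ + 1, by positivity, fun t ht x hx => ?_⟩
  have ht1 : T₁ ≤ t - 1 := by linarith [le_max_left T₁ T₂]
  have ht2 : T₂ ≤ t - 1 := by linarith [le_max_right T₁ T₂]
  obtain ⟨s, hs, hVs⟩ : ∃ s ∈ Icc (t - 1) t, S.V s ≤ δ := by
    by_contra! hcon
    have h1 := intervalIntegral.integral_mono_on (show t - 1 ≤ t by linarith)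
      (continuous_const.intervalIntegrable (μ := volume) _ _) (S.cV.intervalIntegrable _ _)
      fun s hs => (hcon s hs).le
    have h2 := htail (t - 1) ht2 t (by linarith)
    simp only [intervalIntegral.integral_const, sub_sub_cancel, one_smul] at h1
    linarith
  exact hfwd s (ht1.trans hs.1) hVs t ⟨hs.2, by linarith [hs.1]⟩ x hx

end GlobalSol

theorem NSSol.toGlobalSol_A (S : NSSol) : S.toGlobalSol.A = S.A := by
  have hv : ∀ x ∈ uIcc (0 : ℝ) 1, S.toGlobalSol.v x 0 = S.v x 0 := fun x hx =>
    clampExtend_eq S.v (by rwa [uIcc_of_le zero_le_one] at hx) le_rfl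
  have hθ : ∀ x ∈ uIcc (0 : ℝ) 1, S.toGlobalSol.θ x 0 = S.θ x 0 := fun x hx =>
    clampExtend_eq S.θ (by rwa [uIcc_of_le zero_le_one] at hx) le_rfl
  have hm : S.toGlobalSol.m = ∫ x in (0 : ℝ)..1, S.v x 0 := intervalIntegral.integral_congr hv
  have hE : S.toGlobalSol.E = S.E₀ := intervalIntegral.integral_congr fun x hx => by
    simp only [hv x hx, hθ x hx]
  rw [GlobalSol.A, NSSol.A, hm, hE]

/-- As `t → ∞`, `θ(·,t) → A` uniformly on `[0,1]`. -/
theorem theta_uniform_convergence (S : NSSol) :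
    ∀ ε > (0:ℝ), ∃ T : ℝ, ∀ t ≥ T, ∀ x ∈ Icc (0:ℝ) 1, |S.θ x t - S.A| < ε := by
  intro ε hε
  obtain ⟨T, hT, h⟩ := S.toGlobalSol.eventually_abs_sub_A_lt hε
  refine ⟨T, fun t ht x hx => ?_⟩
  have h1 := h t ht x hx
  rwa [S.toGlobalSol_A,
    show S.toGlobalSol.θ x t = S.θ x t from clampExtend_eq S.θ hx (hT.trans ht)] at h1
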